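/- For every C > 0 there exist ε₀ > 0 and N such that the following holds for all n ≥ N. Let k be an integer with |k − (2·log₂ n − 2·log₂ log n)| ≤ C, let r be an integer with 1 ≤ r ≤ ε₀·log log n, and let j be an integer with 0 < j ≤ r. Then P(α_{r+1}(G_{n,1/2}) ≥ kr + j) ≥ P(Z_{k+1,μ_j} ≥ ξ_j) − 1/log n. -/

import Mathlib

open scoped Classical

/-- Probability of an event under the uniform measure on simple graphs on `Fin n`
(equivalently, `G_{n,1/2}`). -/
noncomputable def grPr (n : ℕ) (S : Set (SimpleGraph (Fin n))) : ℝ :=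
  ((PMF.uniformOfFintype (SimpleGraph (Fin n))).toOuterMeasure S).toReal

/-- Number of edges of `G` with both endpoints in `s`. -/
noncomputable def edgesIn {n : ℕ} (G : SimpleGraph (Fin n)) (s : Finset (Fin n)) : ℕ :=
  {e ∈ G.edgeSet | ∀ v ∈ e, v ∈ s}.ncard

/-- `Z_{k,i}(G)`: the number of `k`-element vertex subsets inducing exactly `i` edges. -/
noncomputable def numZ (n k i : ℕ) (G : SimpleGraph (Fin n)) : ℕ :=
  (((Finset.univ : Finset (Fin n)).powersetCard k).filter (fun s => edgesIn G s = i)).card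

/-- `α_r(G)`: the maximum number of vertices in an induced `K_r`-free subgraph of `G`. -/
noncomputable def alphaClq (n r : ℕ) (G : SimpleGraph (Fin n)) : ℕ :=
  sSup {m | ∃ s : Finset (Fin n), s.card = m ∧ (G.induce (s : Set (Fin n))).CliqueFree r}

/-- `μ_j = ⌊(r - j)/j⌋`. -/
def muD (r j : ℕ) : ℕ := (r - j) / j

/-- `ξ_j = j(μ_j + 2) - r`. -/
def xiD (r j : ℕ) : ℕ := j * (muD r j + 2) - r

section Probability

variable {n : ℕ}

/-- Average of `f` over all graphs on `Fin n`. -/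
noncomputable def graphAvg (f : SimpleGraph (Fin n) → ℝ) : ℝ :=
  (∑ G, f G) / Fintype.card (SimpleGraph (Fin n))

/-- Probability of a graph property under the uniform measure. -/
noncomputable def graphPr (P : SimpleGraph (Fin n) → Prop) : ℝ :=
  graphAvg fun G => if P G then 1 else 0

lemma card_graph_pos : (0 : ℝ) < Fintype.card (SimpleGraph (Fin n)) := by
  exact_mod_cast Fintype.card_pos

lemma grPr_eq_graphPr (P : SimpleGraph (Fin n) → Prop) : grPr n {G | P G} = graphPr P := by
  rw [grPr, PMF.toOuterMeasure_uniformOfFintype_apply, graphPr, graphAvg, ENNReal.toReal_div]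
  simp [Fintype.card_subtype]

lemma graphAvg_mono {f g : SimpleGraph (Fin n) → ℝ} (h : ∀ G, f G ≤ g G) :
    graphAvg f ≤ graphAvg g := by
  unfold graphAvg
  have := @card_graph_pos n
  gcongr
  exact h _

lemma graphAvg_add (f g : SimpleGraph (Fin n) → ℝ) :
    graphAvg (fun G => f G + g G) = graphAvg f + graphAvg g := by
  simp [graphAvg, Finset.sum_add_distrib, add_div]

lemma graphAvg_mul_left (c : ℝ) (f : SimpleGraph (Fin n) → ℝ) :
    graphAvg (fun G => c * f G) = c * graphAvg f := by
  simp [graphAvg, ← Finset.mul_sum, mul_div_assoc]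

lemma graphAvg_const (c : ℝ) : graphAvg (fun _ : SimpleGraph (Fin n) => c) = c := by
  have := (@card_graph_pos n).ne'
  simp only [graphAvg, Finset.sum_const, nsmul_eq_mul, Finset.card_univ]
  field_simp

lemma graphAvg_sum {ι : Type*} (s : Finset ι) (f : ι → SimpleGraph (Fin n) → ℝ) :
    graphAvg (fun G => ∑ i ∈ s, f i G) = ∑ i ∈ s, graphAvg (f i) := by
  simp only [graphAvg, ← Finset.sum_div]
  rw [Finset.sum_comm]

lemma graphPr_nonneg (P : SimpleGraph (Fin n) → Prop) : 0 ≤ graphPr P := by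
  unfold graphPr graphAvg
  positivity

lemma graphPr_mono {P Q : SimpleGraph (Fin n) → Prop} (h : ∀ G, P G → Q G) :
    graphPr P ≤ graphPr Q := by
  refine graphAvg_mono fun G => ?_
  have := h G
  by_cases hP : P G <;> by_cases hQ : Q G <;> simp_all

lemma graphPr_le_one (P : SimpleGraph (Fin n) → Prop) : graphPr P ≤ 1 := by
  rw [← graphAvg_const (n := n) 1]
  refine graphAvg_mono fun G => ?_
  split_ifs <;> simp

lemma graphPr_true : graphPr (fun _ : SimpleGraph (Fin n) => True) = 1 := by
  simp [graphPr, graphAvg_const]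

lemma graphPr_or_le (P Q : SimpleGraph (Fin n) → Prop) :
    graphPr (fun G => P G ∨ Q G) ≤ graphPr P + graphPr Q := by
  unfold graphPr
  rw [← graphAvg_add]
  refine graphAvg_mono fun G => ?_
  by_cases hP : P G <;> by_cases hQ : Q G <;> simp_all

lemma graphPr_not (P : SimpleGraph (Fin n) → Prop) :
    graphPr (fun G => ¬ P G) = 1 - graphPr P := by
  rw [eq_sub_iff_add_eq]
  unfold graphPr
  rw [← graphAvg_add]
  refine Eq.trans ?_ (graphAvg_const (n := n) 1)
  congr 1
  funext G
  by_cases hP : P G <;> simp [hP]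

lemma graphPr_exists_le {ι : Type*} (s : Finset ι) (A : ι → SimpleGraph (Fin n) → Prop) :
    graphPr (fun G => ∃ i ∈ s, A i G) ≤ ∑ i ∈ s, graphPr (A i) := by
  unfold graphPr
  rw [← graphAvg_sum]
  refine graphAvg_mono fun G => ?_
  have h0 : ∀ i ∈ s, (0 : ℝ) ≤ if A i G then 1 else 0 := fun i _ => by split_ifs <;> simp
  split_ifs with h
  · obtain ⟨i, hi, hA⟩ := h
    refine le_trans ?_ (Finset.single_le_sum h0 hi)
    simp [hA]
  · exact Finset.sum_nonneg h0

/-- A disjoint decomposition of a property. -/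
lemma graphPr_exists_eq {ι : Type*} (s : Finset ι) (A : ι → SimpleGraph (Fin n) → Prop)
    (h : ∀ G, ∀ i ∈ s, ∀ j ∈ s, A i G → A j G → i = j) :
    graphPr (fun G => ∃ i ∈ s, A i G) = ∑ i ∈ s, graphPr (A i) := by
  unfold graphPr
  rw [← graphAvg_sum]
  congr 1
  funext G
  split_ifs with h'
  · obtain ⟨i, hi, hA⟩ := h'
    rw [Finset.sum_eq_single i]
    · simp [hA]
    · intro j hj hne
      rw [if_neg]
      exact fun hAj => hne (h G j hj i hi hAj hA)
    · exact fun h => absurd hi h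
  · rw [Finset.sum_eq_zero]
    intro i hi
    rw [if_neg]
    exact fun hA => h' ⟨i, hi, hA⟩

lemma graphAvg_card_filter {ι : Type*} (s : Finset ι) (A : ι → SimpleGraph (Fin n) → Prop)
    [∀ G, DecidablePred fun i => A i G] :
    graphAvg (fun G => ((s.filter fun i => A i G).card : ℝ)) = ∑ i ∈ s, graphPr (A i) := by
  unfold graphPr
  rw [← graphAvg_sum]
  refine congrArg graphAvg (funext fun G => ?_)
  rw [Finset.card_filter]
  push_cast
  exact Finset.sum_congr rfl fun i _ => by congr

lemma graphPr_markov (f : SimpleGraph (Fin n) → ℝ) (hf : ∀ G, 0 ≤ f G) {a : ℝ} (ha : 0 < a) :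
    graphPr (fun G => a ≤ f G) ≤ graphAvg f / a := by
  rw [le_div_iff₀ ha, mul_comm, graphPr, ← graphAvg_mul_left]
  refine graphAvg_mono fun G => ?_
  split_ifs with h
  · simpa using h
  · simpa using hf G

/-- The second moment method, with the correlated pairs given by the relation `c`. -/
lemma graphPr_chebyshev {ι : Type*} (s : Finset ι) (A : ι → SimpleGraph (Fin n) → Prop)
    (c : ι → ι → Prop) [DecidablePred fun x : ι × ι => c x.1 x.2] {p : ℝ} (hp : 0 < p)
    (hs : s.Nonempty)
    (hA : ∀ i ∈ s, graphPr (A i) = p)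
    (hc : ∀ i ∈ s, ∀ j ∈ s, ¬ c i j → graphPr (fun G => A i G ∧ A j G) ≤ p ^ 2) :
    graphPr (fun G => ((s.filter fun i => A i G).card : ℝ) ≤ s.card * p / 2) ≤
      4 * (∑ x ∈ (s ×ˢ s).filter (fun x => c x.1 x.2),
        graphPr (fun G => A x.1 G ∧ A x.2 G)) / (s.card * p) ^ 2 := by
  set D := ∑ x ∈ (s ×ˢ s).filter (fun x => c x.1 x.2), graphPr (fun G => A x.1 G ∧ A x.2 G)
  set m : ℝ := s.card * p with hm
  have hs' : (0 : ℝ) < s.card := by exact_mod_cast hs.card_pos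
  have hm0 : 0 < m := by positivity
  set X : SimpleGraph (Fin n) → ℝ := fun G => ((s.filter fun i => A i G).card : ℝ) with hX
  have h1 : graphAvg X = m := by
    rw [hX, graphAvg_card_filter, Finset.sum_congr rfl hA]
    simp [hm]
  have h2 : graphAvg (fun G => X G ^ 2) ≤ D + m ^ 2 := by
    have : (fun G => X G ^ 2) = fun G =>
        ((((s ×ˢ s).filter fun x => A x.1 G ∧ A x.2 G).card : ℕ) : ℝ) := by
      funext G
      rw [hX, sq, ← Nat.cast_mul, ← Finset.card_product]
      congr 2
      ext x
      simp only [Finset.mem_product, Finset.mem_filter]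
      tauto
    rw [this, graphAvg_card_filter (s ×ˢ s) (fun x G => A x.1 G ∧ A x.2 G),
      ← Finset.sum_filter_add_sum_filter_not (s ×ˢ s) (fun x => c x.1 x.2)]
    gcongr
    calc _ ≤ ∑ x ∈ (s ×ˢ s).filter (fun x => ¬ c x.1 x.2), p ^ 2 := by
          refine Finset.sum_le_sum fun x hx => ?_
          simp only [Finset.mem_filter, Finset.mem_product] at hx
          exact hc _ hx.1.1 _ hx.1.2 hx.2
      _ ≤ ∑ x ∈ s ×ˢ s, p ^ 2 :=
          Finset.sum_le_sum_of_subset_of_nonneg (Finset.filter_subset _ _)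
            fun _ _ _ => by positivity
      _ = m ^ 2 := by
          simp [hm]
          ring
  have h3 : graphAvg (fun G => (X G - m) ^ 2) ≤ D := by
    have : (fun G => (X G - m) ^ 2) = fun G => X G ^ 2 + ((-2 * m) * X G + m ^ 2) := by
      funext G
      ring
    rw [this, graphAvg_add, graphAvg_add, graphAvg_mul_left, graphAvg_const, h1]
    nlinarith
  calc graphPr (fun G => X G ≤ m / 2)
      ≤ graphPr (fun G => m ^ 2 / 4 ≤ (X G - m) ^ 2) := by
        refine graphPr_mono fun G hG => ?_
        nlinarith
    _ ≤ graphAvg (fun G => (X G - m) ^ 2) / (m ^ 2 / 4) :=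
        graphPr_markov _ (fun G => sq_nonneg _) (by positivity)
    _ ≤ D / (m ^ 2 / 4) := by gcongr
    _ = 4 * D / m ^ 2 := by field_simp

end Probability

section Independence

variable {n : ℕ}

/-- The property `P` only depends on the edges in `D`. -/
def DeterminedBy (D : Set (Sym2 (Fin n))) (P : SimpleGraph (Fin n) → Prop) : Prop :=
  ∀ G H : SimpleGraph (Fin n), (∀ e ∈ D, e ∈ G.edgeSet ↔ e ∈ H.edgeSet) → (P G ↔ P H)

/-- The graph agreeing with `G` on `D` and with `H` off `D`. -/
def mixGraph (D : Set (Sym2 (Fin n))) (G H : SimpleGraph (Fin n)) : SimpleGraph (Fin n) where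
  Adj u v := (s(u, v) ∈ D ∧ G.Adj u v) ∨ (s(u, v) ∉ D ∧ H.Adj u v)
  symm := ⟨fun u v h => by rwa [Sym2.eq_swap, G.adj_comm, H.adj_comm]⟩
  loopless := ⟨fun u h => by simp at h⟩

lemma mem_mixGraph_of_mem {D : Set (Sym2 (Fin n))} {G H : SimpleGraph (Fin n)}
    {e : Sym2 (Fin n)} (he : e ∈ D) :
    e ∈ (mixGraph D G H).edgeSet ↔ e ∈ G.edgeSet := by
  induction e with | _ u v => simp [mixGraph, he]

lemma mem_mixGraph_of_notMem {D : Set (Sym2 (Fin n))} {G H : SimpleGraph (Fin n)}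
    {e : Sym2 (Fin n)} (he : e ∉ D) :
    e ∈ (mixGraph D G H).edgeSet ↔ e ∈ H.edgeSet := by
  induction e with | _ u v => simp [mixGraph, he]

lemma mixGraph_mixGraph (D : Set (Sym2 (Fin n))) (G H : SimpleGraph (Fin n)) :
    mixGraph D (mixGraph D G H) (mixGraph D H G) = G := by
  ext u v
  by_cases h : s(u, v) ∈ D <;> simp [mixGraph, h]

lemma graphPr_eq_card (P : SimpleGraph (Fin n) → Prop) :
    graphPr P = (Finset.univ.filter P).card / Fintype.card (SimpleGraph (Fin n)) := by
  simp [graphPr, graphAvg]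

lemma graphPr_and_of_disjoint {D D' : Set (Sym2 (Fin n))} {P Q : SimpleGraph (Fin n) → Prop}
    (hP : DeterminedBy D P) (hQ : DeterminedBy D' Q) (hD : Disjoint D D') :
    graphPr (fun G => P G ∧ Q G) = graphPr P * graphPr Q := by
  have key : (Finset.univ.filter P ×ˢ Finset.univ.filter Q).card =
      (Finset.univ.filter (fun G => P G ∧ Q G) ×ˢ
        (Finset.univ : Finset (SimpleGraph (Fin n)))).card := by
    have hPm : ∀ G H, P (mixGraph D G H) ↔ P G := fun G H =>
      hP _ _ fun e he => mem_mixGraph_of_mem he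
    have hQm : ∀ G H, Q (mixGraph D G H) ↔ Q H := fun G H =>
      hQ _ _ fun e he => mem_mixGraph_of_notMem (hD.notMem_of_mem_right he)
    refine Finset.card_nbij' (fun x => (mixGraph D x.1 x.2, mixGraph D x.2 x.1))
      (fun x => (mixGraph D x.1 x.2, mixGraph D x.2 x.1)) ?_ ?_ ?_ ?_
    · intro x hx
      simpa [hPm, hQm] using hx
    · intro x hx
      simpa [hPm, hQm] using hx
    · intro x _
      simp [mixGraph_mixGraph]
    · intro x _
      simp [mixGraph_mixGraph]
  rw [Finset.card_product, Finset.card_product, Finset.card_univ] at key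
  have key' : ((Finset.univ.filter P).card : ℝ) * (Finset.univ.filter Q).card =
    (Finset.univ.filter (fun G => P G ∧ Q G)).card * Fintype.card (SimpleGraph (Fin n)) := by
    exact_mod_cast key
  have := (@card_graph_pos n).ne'
  simp only [graphPr_eq_card]
  field_simp
  convert key'.symm

/-- Flip the edges in `F`. -/
lemma mem_edgeSet_symmDiff (G : SimpleGraph (Fin n)) (F : Finset (Sym2 (Fin n)))
    {e : Sym2 (Fin n)} (he : ¬ e.IsDiag) :
    e ∈ (symmDiff G (SimpleGraph.fromEdgeSet (F : Set (Sym2 (Fin n))))).edgeSet ↔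
      ((e ∈ G.edgeSet ∧ e ∉ F) ∨ (e ∈ F ∧ e ∉ G.edgeSet)) := by
  induction e with | _ u v =>
  simp only [Sym2.mk_isDiag_iff] at he
  simp [symmDiff, he]

lemma graphPr_edges_eq (D : Finset (Sym2 (Fin n))) (hD : ∀ e ∈ D, ¬ e.IsDiag)
    {F : Finset (Sym2 (Fin n))} (hF : F ⊆ D) :
    graphPr (fun G => D.filter (fun e => e ∈ G.edgeSet) = F) = (1 / 2) ^ D.card := by
  set c := graphPr (fun G : SimpleGraph (Fin n) => D.filter (fun e => e ∈ G.edgeSet) = ∅) with hc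
  have h1 : ∀ F ∈ D.powerset,
      graphPr (fun G => D.filter (fun e => e ∈ G.edgeSet) = F) = c := by
    intro F hF
    rw [Finset.mem_powerset] at hF
    rw [hc, graphPr_eq_card, graphPr_eq_card]
    congr 2
    refine Finset.card_nbij'
      (fun G => symmDiff G (SimpleGraph.fromEdgeSet (F : Set (Sym2 (Fin n)))))
      (fun G => symmDiff G (SimpleGraph.fromEdgeSet (F : Set (Sym2 (Fin n))))) ?_ ?_ ?_ ?_
    · intro G hG
      simp only [Finset.coe_filter, Finset.mem_univ, true_and, Set.mem_ofPred_eq,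
        Finset.filter_eq_empty_iff] at hG ⊢
      intro e he
      rw [mem_edgeSet_symmDiff _ _ (hD e he), ← hG]
      simp [he]
    · intro G hG
      simp only [Finset.coe_filter, Finset.mem_univ, true_and, Set.mem_ofPred_eq,
        Finset.filter_eq_empty_iff] at hG ⊢
      ext e
      rw [Finset.mem_filter]
      constructor
      · rintro ⟨he, h⟩
        rw [mem_edgeSet_symmDiff _ _ (hD e he)] at h
        have := hG he
        tauto
      · intro he
        refine ⟨hF he, ?_⟩
        rw [mem_edgeSet_symmDiff _ _ (hD e (hF he))]
        exact Or.inr ⟨he, hG (hF he)⟩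
    · intro G _
      simp
    · intro G _
      simp
  have h2 : (1 : ℝ) = 2 ^ D.card * c := by
    rw [← graphPr_true (n := n)]
    have : (fun _ : SimpleGraph (Fin n) => True) =
        fun G => ∃ F ∈ D.powerset, D.filter (fun e => e ∈ G.edgeSet) = F := by
      funext G
      simp
    rw [this, graphPr_exists_eq, Finset.sum_congr rfl h1]
    · simp
    · intro G i _ j _ hi hj
      rw [← hi, ← hj]
  rw [h1 F (Finset.mem_powerset.2 hF), one_div, inv_pow]
  exact eq_inv_of_mul_eq_one_right h2.symm

lemma determinedBy_edges (D : Finset (Sym2 (Fin n))) (f : Finset (Sym2 (Fin n)) → Prop) :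
    DeterminedBy (D : Set (Sym2 (Fin n)))
      (fun G => f (D.filter fun e => e ∈ G.edgeSet)) := by
  intro G H h
  have : D.filter (fun e => e ∈ G.edgeSet) = D.filter (fun e => e ∈ H.edgeSet) :=
    Finset.filter_congr fun e he => h e he
  simp only [this]

lemma graphPr_card_edges_eq (D : Finset (Sym2 (Fin n))) (hD : ∀ e ∈ D, ¬ e.IsDiag) (i : ℕ) :
    graphPr (fun G => (D.filter fun e => e ∈ G.edgeSet).card = i) =
      D.card.choose i * (1 / 2) ^ D.card := by
  have : (fun G : SimpleGraph (Fin n) => (D.filter fun e => e ∈ G.edgeSet).card = i) =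
      fun G => ∃ F ∈ D.powersetCard i, D.filter (fun e => e ∈ G.edgeSet) = F := by
    funext G
    simp [Finset.mem_powersetCard]
  rw [this, graphPr_exists_eq, Finset.sum_congr rfl fun F hF =>
    graphPr_edges_eq D hD (Finset.mem_powersetCard.1 hF).1]
  · simp
  · intro G i _ j _ hi hj
    rw [← hi, ← hj]

lemma graphPr_card_edges_le (D : Finset (Sym2 (Fin n))) (hD : ∀ e ∈ D, ¬ e.IsDiag) (q : ℕ) :
    graphPr (fun G => (D.filter fun e => e ∈ G.edgeSet).card ≤ q) =
      (∑ i ∈ Finset.range (q + 1), (D.card.choose i : ℝ)) * (1 / 2) ^ D.card := by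
  have : (fun G : SimpleGraph (Fin n) => (D.filter fun e => e ∈ G.edgeSet).card ≤ q) =
      fun G => ∃ i ∈ Finset.range (q + 1), (D.filter fun e => e ∈ G.edgeSet).card = i := by
    funext G
    simp
  rw [this, graphPr_exists_eq, Finset.sum_congr rfl fun i _ => graphPr_card_edges_eq D hD i,
    Finset.sum_mul]
  intro G i _ j _ hi hj
  rw [← hi, ← hj]

/-- No vertex of `J` is adjacent to both `u` and `v`. -/
def NoCommon (u v : Fin n) (J : Finset (Fin n)) (G : SimpleGraph (Fin n)) : Prop :=
  ∀ w ∈ J, ¬ (G.Adj u w ∧ G.Adj v w)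

/-- The pairs joining `J` to `u` or `v`. -/
def starPairs (u v : Fin n) (J : Finset (Fin n)) : Set (Sym2 (Fin n)) :=
  {e | ∃ w ∈ J, e = s(u, w) ∨ e = s(v, w)}

lemma determinedBy_noCommon (u v : Fin n) (J : Finset (Fin n)) :
    DeterminedBy (starPairs u v J) (NoCommon u v J) := by
  intro G H h
  refine forall₂_congr fun w hw => ?_
  have h1 := h s(u, w) ⟨w, hw, Or.inl rfl⟩
  have h2 := h s(v, w) ⟨w, hw, Or.inr rfl⟩
  simp only [SimpleGraph.mem_edgeSet] at h1 h2
  rw [h1, h2]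

lemma graphPr_noCommon {u v : Fin n} (huv : u ≠ v) (J : Finset (Fin n)) (hu : u ∉ J)
    (hv : v ∉ J) : graphPr (NoCommon u v J) = (3 / 4) ^ J.card := by
  induction J using Finset.induction_on with
  | empty =>
    have : NoCommon u v ∅ = fun _ => True := by
      funext G
      simp [NoCommon]
    rw [this, graphPr_true]
    simp
  | insert w J hw ih =>
    simp only [Finset.mem_insert, not_or] at hu hv
    have h0 : NoCommon u v (insert w J) = fun G => NoCommon u v {w} G ∧ NoCommon u v J G := by
      funext G
      simp [NoCommon]
    have hd : Disjoint (starPairs u v {w}) (starPairs u v J) := by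
      rw [Set.disjoint_left]
      rintro e ⟨a, ha, hea⟩ ⟨b, hb, heb⟩
      rw [Finset.mem_singleton] at ha
      subst ha
      have hab : a ≠ b := fun h => hw (h ▸ hb)
      have hub : u ≠ b := fun h => hu.2 (h ▸ hb)
      have hvb : v ≠ b := fun h => hv.2 (h ▸ hb)
      rcases hea with rfl | rfl <;> rcases heb with heb | heb <;>
        rw [Sym2.eq_iff] at heb <;> grind
    have hw1 : graphPr (NoCommon u v {w}) = 3 / 4 := by
      have h1 : NoCommon u v {w} = fun G =>
          ¬ (({s(u, w), s(v, w)} : Finset (Sym2 (Fin n))).filter fun e => e ∈ G.edgeSet) =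
            {s(u, w), s(v, w)} := by
        funext G
        simp [NoCommon, Finset.filter_eq_self]
      have hne : s(u, w) ≠ s(v, w) := by
        rw [Ne, Sym2.eq_iff]
        grind
      rw [h1, graphPr_not, graphPr_edges_eq _ _ (Finset.Subset.refl _), Finset.card_pair hne]
      · norm_num
      · intro e he
        simp only [Finset.mem_insert, Finset.mem_singleton] at he
        rcases he with rfl | rfl
        · simpa using hu.1
        · simpa using hv.1
    rw [h0, graphPr_and_of_disjoint (determinedBy_noCommon u v {w}) (determinedBy_noCommon u v J)
      hd, ih hu.2 hv.2, hw1, Finset.card_insert_of_notMem hw, pow_succ, mul_comm]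

end Independence

section Counting

variable {n : ℕ}

/-- The pairs of distinct elements of `s`. -/
noncomputable def pairsIn (s : Finset (Fin n)) : Finset (Sym2 (Fin n)) :=
  s.sym2.filter fun e => ¬ e.IsDiag

lemma mem_pairsIn {s : Finset (Fin n)} {e : Sym2 (Fin n)} :
    e ∈ pairsIn s ↔ (∀ v ∈ e, v ∈ s) ∧ ¬ e.IsDiag := by
  simp [pairsIn, Finset.mem_sym2_iff]

lemma mk_mem_pairsIn {s : Finset (Fin n)} {u v : Fin n} :
    s(u, v) ∈ pairsIn s ↔ (u ∈ s ∧ v ∈ s) ∧ u ≠ v := by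
  simp [mem_pairsIn]

lemma card_pairsIn (s : Finset (Fin n)) : (pairsIn s).card = s.card.choose 2 := by
  rw [← Sym2.card_image_offDiag]
  congr 1
  ext e
  induction e with | _ u v =>
  simp only [mk_mem_pairsIn, Finset.mem_image, Finset.mem_offDiag, Prod.exists]
  constructor
  · rintro ⟨⟨hu, hv⟩, huv⟩
    exact ⟨u, v, ⟨hu, hv, huv⟩, rfl⟩
  · rintro ⟨a, b, ⟨ha, hb, hab⟩, h⟩
    rcases Sym2.eq_iff.1 h with ⟨rfl, rfl⟩ | ⟨rfl, rfl⟩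
    · exact ⟨⟨ha, hb⟩, hab⟩
    · exact ⟨⟨hb, ha⟩, hab.symm⟩

lemma not_isDiag_of_mem_pairsIn {s : Finset (Fin n)} :
    ∀ e ∈ pairsIn s, ¬ e.IsDiag := fun _ he => (mem_pairsIn.1 he).2

lemma pairsIn_inter (s t : Finset (Fin n)) : pairsIn s ∩ pairsIn t = pairsIn (s ∩ t) := by
  ext e
  simp only [Finset.mem_inter, mem_pairsIn]
  grind

lemma disjoint_pairsIn {s t : Finset (Fin n)} (h : Disjoint s t) :
    Disjoint (pairsIn s) (pairsIn t) := by
  rw [Finset.disjoint_iff_inter_eq_empty, pairsIn_inter, Finset.disjoint_iff_inter_eq_empty.1 h]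
  rfl

lemma card_pairsIn_union (s t : Finset (Fin n)) :
    (pairsIn s ∪ pairsIn t).card + (s ∩ t).card.choose 2 =
      s.card.choose 2 + t.card.choose 2 := by
  rw [← card_pairsIn, ← pairsIn_inter, Finset.card_union_add_card_inter, card_pairsIn,
    card_pairsIn]

lemma edgesIn_eq (G : SimpleGraph (Fin n)) (s : Finset (Fin n)) :
    edgesIn G s = ((pairsIn s).filter fun e => e ∈ G.edgeSet).card := by
  rw [edgesIn, ← Set.ncard_coe_finset]
  congr 1
  ext e
  simp only [Set.mem_ofPred_eq, Finset.coe_filter, mem_pairsIn]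
  have := G.not_isDiag_of_mem_edgeSet (e := e)
  tauto

lemma card_filter_inter_card_le {κ l : ℕ} {W I : Finset (Fin n)}
    (hI : I ∈ W.powersetCard κ) :
    ((W.powersetCard κ).filter fun J => (I ∩ J).card = l).card ≤
      κ.choose l * (W.card - κ).choose (κ - l) := by
  rw [Finset.mem_powersetCard] at hI
  have h1 : κ.choose l * (W.card - κ).choose (κ - l) =
      (I.powersetCard l ×ˢ (W \ I).powersetCard (κ - l)).card := by
    rw [Finset.card_product, Finset.card_powersetCard, Finset.card_powersetCard, hI.2,
      Finset.card_sdiff_of_subset hI.1, hI.2]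
  rw [h1]
  refine Finset.card_le_card_of_injOn (fun J => (I ∩ J, J \ I)) ?_ ?_
  · intro J hJ
    simp only [Finset.coe_filter, Finset.mem_powersetCard, Set.mem_ofPred_eq] at hJ
    simp only [Finset.coe_product, Set.mem_prod, Finset.mem_coe, Finset.mem_powersetCard]
    refine ⟨⟨Finset.inter_subset_left, hJ.2⟩, Finset.sdiff_subset_sdiff hJ.1.1 le_rfl, ?_⟩
    have := Finset.card_sdiff_add_card_inter J I
    rw [Finset.inter_comm] at this
    omega
  · intro J _ J' _ h
    simp only [Prod.mk.injEq] at h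
    rw [← Finset.sdiff_union_inter J I, ← Finset.sdiff_union_inter J' I, h.2,
      Finset.inter_comm, h.1, Finset.inter_comm]

lemma two_pow_choose_le_small {κ l : ℕ} {y : ℝ} (hy : 0 < y) (hy4 : y ^ 4 = 2 ^ κ)
    (hl : 2 * l ≤ κ) : (2 : ℝ) ^ l.choose 2 ≤ y ^ l := by
  rw [← pow_le_pow_iff_left₀ (by positivity) (by positivity) (n := 4) (by norm_num),
    ← pow_mul, ← pow_mul, mul_comm l 4, pow_mul y, hy4, ← pow_mul]
  refine pow_le_pow_right₀ (by norm_num) ?_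
  have h2 : l.choose 2 * 2 ≤ l * (l - 1) := by
    rw [Nat.choose_two_right]
    exact Nat.div_mul_le_self _ _
  have h3 : 2 * (l * (l - 1)) ≤ κ * l := by
    have : 2 * (l - 1) ≤ κ := by omega
    calc 2 * (l * (l - 1)) = (2 * (l - 1)) * l := by ring
      _ ≤ κ * l := Nat.mul_le_mul_right _ this
  omega

lemma two_pow_choose_le_large {κ l t : ℕ} {y : ℝ} (hy : 0 < y) (hy4 : y ^ 4 = 2 ^ κ)
    (hlt : l + t = κ) (ht : 2 * t ≤ κ) :
    (2 : ℝ) ^ l.choose 2 * (2 ^ κ) ^ t ≤ 2 ^ κ.choose 2 * (2 * y) ^ t := by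
  rw [← pow_le_pow_iff_left₀ (by positivity) (by positivity) (n := 4) (by norm_num)]
  have h1 : (2 ^ κ.choose 2 * (2 * y) ^ t) ^ 4 = (2 : ℝ) ^ (4 * κ.choose 2 + 4 * t + κ * t) := by
    have : (y ^ t) ^ 4 = 2 ^ (κ * t) := by
      rw [← pow_mul, mul_comm t 4, pow_mul, hy4, ← pow_mul]
    rw [mul_pow, mul_pow, mul_pow, this]
    ring
  have h2 : ((2 : ℝ) ^ l.choose 2 * (2 ^ κ) ^ t) ^ 4 =
      2 ^ (4 * l.choose 2 + 4 * (κ * t)) := by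
    ring
  rw [h1, h2]
  refine pow_le_pow_right₀ (by norm_num) ?_
  have h3 : ∀ m : ℕ, (m.choose 2 : ℤ) * 2 = m * (m - 1) := by
    intro m
    cases m with
    | zero => simp
    | succ m =>
      have := Nat.add_one_mul_choose_eq m 1
      simp at this
      push_cast
      have h' : ((m : ℤ) + 1) * m = (m + 1).choose 2 * 2 := by exact_mod_cast this
      linarith
  have hl := h3 l
  have hk := h3 κ
  zify
  have ht' : (2 : ℤ) * t ≤ κ := by exact_mod_cast ht
  have hκ : (κ : ℤ) = l + t := by exact_mod_cast hlt.symm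
  have ht0 : (0 : ℤ) ≤ t := by positivity
  have hl0 : (0 : ℤ) ≤ l := by positivity
  rw [hκ] at hk ht' ⊢
  nlinarith

/-- The number of `κ`-subsets meeting a given one in `l` elements, weighted by the gain in
probability, is negligible for `0 < l < κ`. -/
lemma overlap_term_le {κ N l : ℕ} {y b B : ℝ} (hl : 1 ≤ l) (hlκ : l < κ) (hN : κ < N)
    (hy : 0 < y) (hy4 : y ^ 4 = 2 ^ κ) (hb : 1 ≤ b) (hB0 : 0 < B) (hB1 : B ≤ 1)
    (h1 : (κ : ℝ) ^ 3 * y * b ≤ B * (N - κ)) (h2 : 2 * κ * N * y ≤ B * 2 ^ κ) :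
    (κ.choose l * (N - κ).choose (κ - l) : ℝ) * (2 ^ l.choose 2 * b ^ l) ≤
      B * (N.choose κ + b ^ κ * 2 ^ κ.choose 2) := by
  have hNκ : (0 : ℝ) < N - κ := by
    have : (κ : ℝ) < N := by exact_mod_cast hN
    linarith
  rcases le_total (2 * l) κ with hs | hs
  · have hA : (2 : ℝ) ^ l.choose 2 * b ^ l ≤ (y * b) ^ l := by
      rw [mul_pow]
      gcongr
      exact two_pow_choose_le_small hy hy4 hs
    have hC : ((N - κ).choose (κ - l) : ℝ) ≤ (N - l).choose (κ - l) := by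
      exact_mod_cast Nat.choose_le_choose _ (by omega)
    have hD : (N.choose κ : ℝ) * κ.choose l = N.choose l * (N - l).choose (κ - l) := by
      exact_mod_cast Nat.choose_mul hlκ.le
    have hE : (κ.choose l : ℝ) ≤ κ ^ l := by exact_mod_cast Nat.choose_le_pow κ l
    have hF : ((N : ℝ) - κ) ^ l ≤ κ ^ l * N.choose l := by
      have h3 : ((N + 1 - l : ℕ) : ℝ) ^ l ≤ l.factorial * N.choose l := by
        have := Nat.pow_le_choose (α := ℝ) l N
        rwa [div_le_iff₀' (by positivity)] at this
      have h4 : ((N : ℝ) - κ) ^ l ≤ ((N + 1 - l : ℕ) : ℝ) ^ l := by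
        gcongr
        rw [Nat.cast_sub (by omega)]
        push_cast
        have : (l : ℝ) ≤ κ := by exact_mod_cast hlκ.le
        linarith
      have h5 : (l.factorial : ℝ) ≤ κ ^ l := by
        calc (l.factorial : ℝ) ≤ l ^ l := by exact_mod_cast Nat.factorial_le_pow l
          _ ≤ κ ^ l := by gcongr
      calc _ ≤ _ := h4
        _ ≤ _ := h3
        _ ≤ _ := by gcongr
    have hNl : (0 : ℝ) < N.choose l := by exact_mod_cast Nat.choose_pos (by omega)
    have hκ0 : (0 : ℝ) < κ := by exact_mod_cast (by omega : 0 < κ)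
    have hG : (κ.choose l : ℝ) ^ 2 * (y * b) ^ l ≤ B * N.choose l := by
      have : (κ : ℝ) ^ l * ((κ.choose l : ℝ) ^ 2 * (y * b) ^ l) ≤
          (κ : ℝ) ^ l * (B * N.choose l) := by
        calc (κ : ℝ) ^ l * ((κ.choose l : ℝ) ^ 2 * (y * b) ^ l)
            ≤ (κ : ℝ) ^ l * (((κ : ℝ) ^ l) ^ 2 * (y * b) ^ l) := by gcongr
          _ = ((κ : ℝ) ^ 3 * y * b) ^ l := by ring
          _ ≤ (B * (N - κ)) ^ l := by gcongr
          _ = B ^ l * (N - κ) ^ l := by rw [mul_pow]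
          _ ≤ B * (κ ^ l * N.choose l) := by
              gcongr
              calc B ^ l ≤ B ^ 1 := pow_le_pow_of_le_one hB0.le hB1 hl
                _ = B := pow_one B
          _ = _ := by ring
      exact le_of_mul_le_mul_left this (by positivity)
    have hH : (κ.choose l * (N - κ).choose (κ - l) : ℝ) * (2 ^ l.choose 2 * b ^ l) ≤
        B * N.choose κ := by
      have : (N.choose l : ℝ) * ((κ.choose l * (N - κ).choose (κ - l) : ℝ) *
          (2 ^ l.choose 2 * b ^ l)) ≤ N.choose l * (B * N.choose κ) := by
        calc (N.choose l : ℝ) * ((κ.choose l * (N - κ).choose (κ - l) : ℝ) *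
            (2 ^ l.choose 2 * b ^ l))
            ≤ N.choose l * ((κ.choose l * (N - l).choose (κ - l) : ℝ) * (y * b) ^ l) := by
              gcongr
          _ = κ.choose l * (y * b) ^ l * (N.choose l * (N - l).choose (κ - l)) := by ring
          _ = N.choose κ * ((κ.choose l : ℝ) ^ 2 * (y * b) ^ l) := by rw [← hD]; ring
          _ ≤ N.choose κ * (B * N.choose l) := by gcongr
          _ = _ := by ring
      exact le_of_mul_le_mul_left this hNl
    calc _ ≤ B * N.choose κ := hH
      _ ≤ _ := by
        gcongr
        have : 0 ≤ b ^ κ * 2 ^ κ.choose 2 := by positivity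
        linarith
  · obtain ⟨t, rfl⟩ : ∃ t, κ = l + t := ⟨κ - l, by omega⟩
    have ht : 1 ≤ t := by omega
    have hL := two_pow_choose_le_large hy hy4 rfl (l := l) (t := t) (by omega)
    have hA : ((l + t).choose l : ℝ) ≤ ((l + t : ℕ) : ℝ) ^ t := by
      rw [Nat.choose_symm_add]
      exact_mod_cast Nat.choose_le_pow _ t
    have hC : ((N - (l + t)).choose t : ℝ) ≤ (N : ℝ) ^ t := by
      calc ((N - (l + t)).choose t : ℝ) ≤ N.choose t := by
            exact_mod_cast Nat.choose_le_choose _ (by omega)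
        _ ≤ _ := by exact_mod_cast Nat.choose_le_pow _ t
    have hE : b ^ l ≤ b ^ (l + t) := pow_le_pow_right₀ hb (by omega)
    rw [Nat.add_sub_cancel_left]
    have hp : (0 : ℝ) < (2 ^ (l + t)) ^ t := by positivity
    have key : ((l + t).choose l * (N - (l + t)).choose t : ℝ) * (2 ^ l.choose 2 * b ^ l) ≤
        B * (b ^ (l + t) * 2 ^ (l + t).choose 2) := by
      refine le_of_mul_le_mul_right ?_ hp
      calc ((l + t).choose l * (N - (l + t)).choose t : ℝ) * (2 ^ l.choose 2 * b ^ l) *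
          (2 ^ (l + t)) ^ t
          = ((l + t).choose l * (N - (l + t)).choose t : ℝ) * b ^ l *
            (2 ^ l.choose 2 * (2 ^ (l + t)) ^ t) := by ring
        _ ≤ (((l + t : ℕ) : ℝ) ^ t * N ^ t) * b ^ (l + t) *
            (2 ^ (l + t).choose 2 * (2 * y) ^ t) := by gcongr
        _ = b ^ (l + t) * 2 ^ (l + t).choose 2 * (2 * (l + t : ℕ) * N * y) ^ t := by ring
        _ ≤ b ^ (l + t) * 2 ^ (l + t).choose 2 * (B * 2 ^ (l + t)) ^ t := by gcongr
        _ = b ^ (l + t) * 2 ^ (l + t).choose 2 * (B ^ t * (2 ^ (l + t)) ^ t) := by ring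
        _ ≤ b ^ (l + t) * 2 ^ (l + t).choose 2 * (B * (2 ^ (l + t)) ^ t) := by
            gcongr
            calc B ^ t ≤ B ^ 1 := pow_le_pow_of_le_one hB0.le hB1 ht
              _ = B := pow_one B
        _ = _ := by ring
    calc _ ≤ _ := key
      _ ≤ _ := by
        gcongr
        have : (0 : ℝ) ≤ N.choose (l + t) := by positivity
        linarith

/-- Total probability of intersecting pairs of distinct `κ`-subsets of `W`. -/
lemma sum_overlap_le {κ : ℕ} {y b B p R : ℝ} {W : Finset (Fin n)}
    (A : Finset (Fin n) → SimpleGraph (Fin n) → Prop) (hN : κ < W.card)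
    (hy : 0 < y) (hy4 : y ^ 4 = 2 ^ κ) (hb : 1 ≤ b) (hB0 : 0 < B) (hB1 : B ≤ 1)
    (h1 : (κ : ℝ) ^ 3 * y * b ≤ B * (W.card - κ)) (h2 : 2 * κ * W.card * y ≤ B * 2 ^ κ)
    (hR : 0 ≤ R)
    (hA : ∀ I ∈ W.powersetCard κ, ∀ J ∈ W.powersetCard κ,
      graphPr (fun G => A I G ∧ A J G) ≤
        R * p ^ 2 * (2 ^ (I ∩ J).card.choose 2 * b ^ (I ∩ J).card)) :
    ∑ x ∈ (W.powersetCard κ ×ˢ W.powersetCard κ).filter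
        (fun x => x.1 ≠ x.2 ∧ ¬ Disjoint x.1 x.2), graphPr (fun G => A x.1 G ∧ A x.2 G) ≤
      R * p ^ 2 * W.card.choose κ * (κ * (B * (W.card.choose κ + b ^ κ * 2 ^ κ.choose 2))) := by
  have hin : ∀ I ∈ W.powersetCard κ,
      ∑ J ∈ (W.powersetCard κ).filter (fun J => I ≠ J ∧ ¬ Disjoint I J),
        graphPr (fun G => A I G ∧ A J G) ≤
      R * p ^ 2 * (κ * (B * (W.card.choose κ + b ^ κ * 2 ^ κ.choose 2))) := by
    intro I hI
    have hI' := Finset.mem_powersetCard.1 hI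
    have hmap : ∀ J ∈ (W.powersetCard κ).filter (fun J => I ≠ J ∧ ¬ Disjoint I J),
        (I ∩ J).card ∈ Finset.Ico 1 κ := by
      intro J hJ
      simp only [Finset.mem_filter, Finset.mem_powersetCard] at hJ
      rw [Finset.mem_Ico]
      constructor
      · rw [Nat.one_le_iff_ne_zero, Ne, Finset.card_eq_zero]
        exact fun h => hJ.2.2 (Finset.disjoint_iff_inter_eq_empty.2 h)
      · by_contra hlt
        have h3 : I ∩ J = I := Finset.eq_of_subset_of_card_le Finset.inter_subset_left (by omega)
        have h4 : I ∩ J = J := Finset.eq_of_subset_of_card_le Finset.inter_subset_right (by omega)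
        exact hJ.2.1 (h3.symm.trans h4)
    rw [← Finset.sum_fiberwise_of_maps_to hmap]
    calc _ ≤ ∑ l ∈ Finset.Ico 1 κ,
          R * p ^ 2 * (B * (W.card.choose κ + b ^ κ * 2 ^ κ.choose 2)) := by
          refine Finset.sum_le_sum fun l hl => ?_
          rw [Finset.mem_Ico] at hl
          calc _ ≤ ∑ J ∈ ((W.powersetCard κ).filter
                  (fun J => I ≠ J ∧ ¬ Disjoint I J)).filter (fun J => (I ∩ J).card = l),
                R * p ^ 2 * (2 ^ l.choose 2 * b ^ l) := by
                refine Finset.sum_le_sum fun J hJ => ?_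
                simp only [Finset.mem_filter] at hJ
                have := hA I hI J hJ.1.1
                rwa [hJ.2] at this
            _ = (((W.powersetCard κ).filter
                  (fun J => I ≠ J ∧ ¬ Disjoint I J)).filter (fun J => (I ∩ J).card = l)).card *
                  (R * p ^ 2 * (2 ^ l.choose 2 * b ^ l)) := by
                rw [Finset.sum_const, nsmul_eq_mul]
            _ ≤ (κ.choose l * (W.card - κ).choose (κ - l) : ℕ) *
                  (R * p ^ 2 * (2 ^ l.choose 2 * b ^ l)) := by
                gcongr
                refine le_trans (Finset.card_le_card ?_) (card_filter_inter_card_le hI)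
                intro J hJ
                simp only [Finset.mem_filter] at hJ ⊢
                exact ⟨hJ.1.1, hJ.2⟩
            _ = R * p ^ 2 * ((κ.choose l * (W.card - κ).choose (κ - l) : ℝ) *
                  (2 ^ l.choose 2 * b ^ l)) := by
                push_cast
                ring
            _ ≤ _ := by
                refine mul_le_mul_of_nonneg_left ?_ (by positivity)
                exact overlap_term_le hl.1 hl.2 hN hy hy4 hb hB0 hB1 h1 h2
      _ = (κ - 1 : ℕ) * (R * p ^ 2 * (B * (W.card.choose κ + b ^ κ * 2 ^ κ.choose 2))) := by
          rw [Finset.sum_const, nsmul_eq_mul, Nat.card_Ico]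
      _ ≤ κ * (R * p ^ 2 * (B * (W.card.choose κ + b ^ κ * 2 ^ κ.choose 2))) := by
          gcongr
          omega
      _ = _ := by ring
  rw [Finset.sum_filter, Finset.sum_product]
  calc _ ≤ ∑ I ∈ W.powersetCard κ,
        R * p ^ 2 * (κ * (B * (W.card.choose κ + b ^ κ * 2 ^ κ.choose 2))) := by
        refine Finset.sum_le_sum fun I hI => ?_
        rw [← Finset.sum_filter]
        exact hin I hI
    _ = _ := by
        rw [Finset.sum_const, nsmul_eq_mul, Finset.card_powersetCard]
        ring

end Counting

section SecondMoment

variable {n : ℕ}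

/-- Parameters for which the overlap sums of the second moment method are negligible. -/
def SmallOverlap (κ N : ℕ) (b B : ℝ) : Prop :=
  1 ≤ κ ∧ κ < N ∧ 1 ≤ b ∧ 0 < B ∧ B ≤ 1 ∧ ∃ y : ℝ, 0 < y ∧ y ^ 4 = 2 ^ κ ∧
    (κ : ℝ) ^ 3 * y * b ≤ B * (N - κ) ∧ 2 * κ * N * y ≤ B * 2 ^ κ

/-- Bound for the relative variance. -/
noncomputable def overlapRatio (κ N : ℕ) (b B R p : ℝ) : ℝ :=
  1 / (N.choose κ * p) + R * κ * B * (1 + b ^ κ * 2 ^ κ.choose 2 / N.choose κ)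

lemma sum_distinct_overlap_le {κ : ℕ} {b B p R : ℝ} {W : Finset (Fin n)}
    (A : Finset (Fin n) → SimpleGraph (Fin n) → Prop) (h : SmallOverlap κ W.card b B)
    (hR : 0 ≤ R)
    (hA : ∀ I ∈ W.powersetCard κ, ∀ J ∈ W.powersetCard κ,
      graphPr (fun G => A I G ∧ A J G) ≤
        R * p ^ 2 * (2 ^ (I ∩ J).card.choose 2 * b ^ (I ∩ J).card)) :
    ∑ x ∈ (W.powersetCard κ ×ˢ W.powersetCard κ).filter
        (fun x => x.1 ≠ x.2 ∧ ¬ Disjoint x.1 x.2), graphPr (fun G => A x.1 G ∧ A x.2 G) ≤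
      (W.card.choose κ * p) ^ 2 *
        (R * κ * B * (1 + b ^ κ * 2 ^ κ.choose 2 / W.card.choose κ)) := by
  obtain ⟨_, hN, hb, hB0, hB1, y, hy, hy4, h1, h2⟩ := h
  have hC : (W.card.choose κ : ℝ) ≠ 0 := by
    exact_mod_cast (Nat.choose_pos hN.le).ne'
  refine (sum_overlap_le A hN hy hy4 hb hB0 hB1 h1 h2 hR hA).trans (le_of_eq ?_)
  field_simp

lemma sum_overlap_le_overlapRatio {κ : ℕ} {b B p R : ℝ} {W : Finset (Fin n)}
    (A : Finset (Fin n) → SimpleGraph (Fin n) → Prop) (h : SmallOverlap κ W.card b B)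
    (hR : 0 ≤ R) (hp : 0 < p)
    (hAp : ∀ I ∈ W.powersetCard κ, graphPr (A I) = p)
    (hA : ∀ I ∈ W.powersetCard κ, ∀ J ∈ W.powersetCard κ,
      graphPr (fun G => A I G ∧ A J G) ≤
        R * p ^ 2 * (2 ^ (I ∩ J).card.choose 2 * b ^ (I ∩ J).card)) :
    ∑ x ∈ (W.powersetCard κ ×ˢ W.powersetCard κ).filter
        (fun x => ¬ Disjoint x.1 x.2), graphPr (fun G => A x.1 G ∧ A x.2 G) ≤
      (W.card.choose κ * p) ^ 2 * overlapRatio κ W.card b B R p := by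
  have hC : (W.card.choose κ : ℝ) ≠ 0 := by
    exact_mod_cast (Nat.choose_pos h.2.1.le).ne'
  have h1 := sum_distinct_overlap_le A h hR hA
  rw [← Finset.sum_filter_add_sum_filter_not _ (fun x => x.1 ≠ x.2), Finset.filter_filter,
    Finset.filter_filter, overlapRatio, mul_add, add_comm]
  refine add_le_add ?_ ?_
  · have : ((W.powersetCard κ ×ˢ W.powersetCard κ).filter
        (fun x => ¬ Disjoint x.1 x.2 ∧ ¬ x.1 ≠ x.2)) ⊆
        (W.powersetCard κ).image fun I => (I, I) := by
      intro x hx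
      simp only [Finset.mem_filter, Finset.mem_product, not_not] at hx
      exact Finset.mem_image.2 ⟨x.1, hx.1.1, by rw [Prod.ext_iff]; exact ⟨rfl, hx.2.2⟩⟩
    calc _ ≤ ∑ x ∈ (W.powersetCard κ).image (fun I => (I, I)),
          graphPr (fun G => A x.1 G ∧ A x.2 G) :=
          Finset.sum_le_sum_of_subset_of_nonneg this fun _ _ _ => graphPr_nonneg _
      _ = ∑ I ∈ W.powersetCard κ, p := by
          rw [Finset.sum_image (by intro a _ b _ hab; exact (Prod.ext_iff.1 hab).1)]
          refine Finset.sum_congr rfl fun I hI => ?_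
          rw [← hAp I hI]
          congr 1
          funext G
          simp
      _ = W.card.choose κ * p := by simp
      _ = _ := by field_simp
  · refine le_trans (le_of_eq ?_) h1
    congr 1
    ext x
    simp only [Finset.mem_filter]
    tauto

lemma graphPr_few_le {κ : ℕ} {b B p R : ℝ} {W : Finset (Fin n)}
    (A : Finset (Fin n) → SimpleGraph (Fin n) → Prop) (h : SmallOverlap κ W.card b B)
    (hR : 0 ≤ R) (hp : 0 < p)
    (hAp : ∀ I ∈ W.powersetCard κ, graphPr (A I) = p)
    (hdis : ∀ I ∈ W.powersetCard κ, ∀ J ∈ W.powersetCard κ, Disjoint I J →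
      graphPr (fun G => A I G ∧ A J G) ≤ p ^ 2)
    (hA : ∀ I ∈ W.powersetCard κ, ∀ J ∈ W.powersetCard κ,
      graphPr (fun G => A I G ∧ A J G) ≤
        R * p ^ 2 * (2 ^ (I ∩ J).card.choose 2 * b ^ (I ∩ J).card)) :
    graphPr (fun G => (((W.powersetCard κ).filter fun I => A I G).card : ℝ) ≤
      W.card.choose κ * p / 2) ≤ 4 * overlapRatio κ W.card b B R p := by
  have hC : (0 : ℝ) < W.card.choose κ := by
    exact_mod_cast Nat.choose_pos h.2.1.le
  have h1 := graphPr_chebyshev (W.powersetCard κ) A (fun I J => ¬ Disjoint I J) hp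
    (Finset.powersetCard_nonempty.2 h.2.1.le) hAp
    (fun I hI J hJ hIJ => hdis I hI J hJ (not_not.1 hIJ))
  rw [Finset.card_powersetCard] at h1
  refine h1.trans ?_
  have h2 := sum_overlap_le_overlapRatio A h hR hp hAp hA
  rw [div_le_iff₀ (by positivity)]
  linarith

/-- If every set of the family `F` meets `U`, then many pairs in `F` intersect. -/
lemma card_sq_le_of_hitting {κ w : ℕ} {U : Finset (Fin n)} {F : Finset (Finset (Fin n))}
    (hU : U.card ≤ w) (hF : ∀ I ∈ F, I.card = κ) (hmeet : ∀ I ∈ F, ¬ Disjoint I U) :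
    F.card ^ 2 ≤ w * κ * ((F ×ˢ F).filter fun x => ¬ Disjoint x.1 x.2).card := by
  have h1 : F.card ≤ ∑ v ∈ U, (F.filter fun I => v ∈ I).card := by
    calc F.card = ∑ I ∈ F, 1 := by simp
      _ ≤ ∑ I ∈ F, (U.filter fun v => v ∈ I).card := by
          refine Finset.sum_le_sum fun I hI => ?_
          obtain ⟨v, hvI, hvU⟩ := Finset.not_disjoint_iff.1 (hmeet I hI)
          exact Finset.card_pos.2 ⟨v, Finset.mem_filter.2 ⟨hvU, hvI⟩⟩
      _ = _ := Finset.sum_card_bipartiteAbove_eq_sum_card_bipartiteBelow _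
  have h2 : ∑ v ∈ U, (F.filter fun I => v ∈ I).card ^ 2 ≤
      κ * ((F ×ˢ F).filter fun x => ¬ Disjoint x.1 x.2).card := by
    calc ∑ v ∈ U, (F.filter fun I => v ∈ I).card ^ 2
        = ∑ v ∈ U, ((F ×ˢ F).filter fun x => v ∈ x.1 ∧ v ∈ x.2).card := by
          refine Finset.sum_congr rfl fun v _ => ?_
          rw [sq, ← Finset.card_product]
          congr 1
          ext x
          simp only [Finset.mem_product, Finset.mem_filter]
          tauto
      _ = ∑ x ∈ F ×ˢ F, (U.filter fun v => v ∈ x.1 ∧ v ∈ x.2).card :=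
          Finset.sum_card_bipartiteAbove_eq_sum_card_bipartiteBelow
            (fun v (x : Finset (Fin n) × Finset (Fin n)) => v ∈ x.1 ∧ v ∈ x.2)
      _ ≤ ∑ x ∈ F ×ˢ F, if ¬ Disjoint x.1 x.2 then κ else 0 := by
          refine Finset.sum_le_sum fun x hx => ?_
          rw [Finset.mem_product] at hx
          split_ifs with hd
          · rw [Nat.le_zero, Finset.card_eq_zero, Finset.filter_eq_empty_iff]
            rintro v _ ⟨h, h'⟩
            exact Finset.disjoint_left.1 hd h h'
          · rw [← hF _ hx.1]
            refine Finset.card_le_card fun v hv => ?_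
            exact (Finset.mem_filter.1 hv).2.1
      _ = _ := by
          rw [← Finset.sum_filter, Finset.sum_const, smul_eq_mul, mul_comm]
  calc F.card ^ 2 ≤ (∑ v ∈ U, (F.filter fun I => v ∈ I).card) ^ 2 := Nat.pow_le_pow_left h1 2
    _ ≤ U.card * ∑ v ∈ U, (F.filter fun I => v ∈ I).card ^ 2 := sq_sum_le_card_mul_sum_sq
    _ ≤ w * (κ * ((F ×ˢ F).filter fun x => ¬ Disjoint x.1 x.2).card) := Nat.mul_le_mul hU h2
    _ = _ := by ring

/-- With high probability no small set meets all the `κ`-subsets satisfying `A`. -/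
lemma graphPr_not_robust_le {κ w : ℕ} {b B p R : ℝ} {W : Finset (Fin n)}
    (A : Finset (Fin n) → SimpleGraph (Fin n) → Prop) (h : SmallOverlap κ W.card b B)
    (hR : 0 ≤ R) (hp : 0 < p)
    (hAp : ∀ I ∈ W.powersetCard κ, graphPr (A I) = p)
    (hdis : ∀ I ∈ W.powersetCard κ, ∀ J ∈ W.powersetCard κ, Disjoint I J →
      graphPr (fun G => A I G ∧ A J G) ≤ p ^ 2)
    (hA : ∀ I ∈ W.powersetCard κ, ∀ J ∈ W.powersetCard κ,
      graphPr (fun G => A I G ∧ A J G) ≤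
        R * p ^ 2 * (2 ^ (I ∩ J).card.choose 2 * b ^ (I ∩ J).card)) :
    graphPr (fun G => ¬ ∀ U : Finset (Fin n), U.card ≤ w →
      ∃ I ∈ W.powersetCard κ, A I G ∧ Disjoint I U) ≤
      (4 * w * κ + 8) * overlapRatio κ W.card b B R p := by
  set m : ℝ := W.card.choose κ * p with hm
  have hC : (0 : ℝ) < W.card.choose κ := by
    exact_mod_cast Nat.choose_pos h.2.1.le
  have hm0 : 0 < m := by positivity
  set F : SimpleGraph (Fin n) → Finset (Finset (Fin n)) :=
    fun G => (W.powersetCard κ).filter fun I => A I G with hFdef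
  set Y : SimpleGraph (Fin n) → ℝ := fun G =>
    ((((W.powersetCard κ ×ˢ W.powersetCard κ).filter (fun x => ¬ Disjoint x.1 x.2)).filter
      fun x => A x.1 G ∧ A x.2 G).card : ℝ) with hY
  have hYF : ∀ G, Y G = ((F G ×ˢ F G).filter fun x => ¬ Disjoint x.1 x.2).card := by
    intro G
    refine congrArg (fun s : Finset (Finset (Fin n) × Finset (Fin n)) => (s.card : ℝ))
      (Finset.ext fun x => ?_)
    simp only [hFdef, Finset.mem_filter, Finset.mem_product]
    tauto
  have ha : 0 < m ^ 2 / (4 * (w * κ + 1)) := by positivity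
  have h1 := graphPr_few_le A h hR hp hAp hdis hA
  have h2 : graphPr (fun G => m ^ 2 / (4 * (w * κ + 1)) ≤ Y G) ≤
      4 * (w * κ + 1) * overlapRatio κ W.card b B R p := by
    refine (graphPr_markov Y (fun G => by positivity) ha).trans ?_
    rw [div_le_iff₀ ha, hY,
      graphAvg_card_filter _ (fun (x : Finset (Fin n) × Finset (Fin n)) G => A x.1 G ∧ A x.2 G)]
    refine (sum_overlap_le_overlapRatio A h hR hp hAp hA).trans (le_of_eq ?_)
    rw [← hm]
    field_simp
  calc _ ≤ graphPr (fun G => ((F G).card : ℝ) ≤ m / 2 ∨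
        m ^ 2 / (4 * (w * κ + 1)) ≤ Y G) := by
        refine graphPr_mono fun G hG => ?_
        push Not at hG
        obtain ⟨U, hU, hI⟩ := hG
        by_contra hcon
        push Not at hcon
        obtain ⟨hX, hYlt⟩ := hcon
        have h3 := card_sq_le_of_hitting (F := F G) (κ := κ) hU
          (fun I hI => (Finset.mem_powersetCard.1 (Finset.mem_filter.1 hI).1).2)
          (fun I hI' => hI I (Finset.mem_filter.1 hI').1 (Finset.mem_filter.1 hI').2)
        have h4 : ((F G).card : ℝ) ^ 2 ≤ w * κ * Y G := by
          rw [hYF]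
          exact_mod_cast h3
        rw [lt_div_iff₀ (by positivity)] at hYlt
        have h5 : (m / 2) ^ 2 < ((F G).card : ℝ) ^ 2 := by gcongr
        have h6 : 0 ≤ Y G := by positivity
        nlinarith
    _ ≤ _ := graphPr_or_le _ _
    _ ≤ 4 * overlapRatio κ W.card b B R p +
        4 * (w * κ + 1) * overlapRatio κ W.card b B R p := add_le_add h1 h2
    _ = _ := by ring

end SecondMoment

section Events

variable {n : ℕ}

lemma sum_choose_le (M q : ℕ) :
    ∑ i ∈ Finset.range (q + 1), M.choose i ≤ (M + 1) ^ q := by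
  rw [add_pow]
  refine Finset.sum_le_sum fun i hi => ?_
  rw [Finset.mem_range] at hi
  calc M.choose i ≤ M ^ i := Nat.choose_le_pow _ _
    _ = M ^ i * 1 ^ (q - i) * 1 := by simp
    _ ≤ _ := Nat.mul_le_mul_left _ (Nat.choose_pos (by omega))

lemma edgesIn_congr {G H : SimpleGraph (Fin n)} {I : Finset (Fin n)}
    (h : ∀ e ∈ pairsIn I, e ∈ G.edgeSet ↔ e ∈ H.edgeSet) : edgesIn G I = edgesIn H I := by
  rw [edgesIn_eq, edgesIn_eq, Finset.filter_congr h]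

lemma determinedBy_edgesIn (I : Finset (Fin n)) (φ : ℕ → Prop) :
    DeterminedBy (pairsIn I : Set (Sym2 (Fin n))) fun G => φ (edgesIn G I) := by
  intro G H h
  simp only [edgesIn_congr h]

lemma graphPr_edgesIn_eq (I : Finset (Fin n)) (i : ℕ) :
    graphPr (fun G => edgesIn G I = i) =
      (I.card.choose 2).choose i * (1 / 2) ^ I.card.choose 2 := by
  simp only [edgesIn_eq]
  rw [graphPr_card_edges_eq _ not_isDiag_of_mem_pairsIn, card_pairsIn]

lemma graphPr_edgesIn_le (I : Finset (Fin n)) (q : ℕ) :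
    graphPr (fun G => edgesIn G I ≤ q) =
      (∑ i ∈ Finset.range (q + 1), ((I.card.choose 2).choose i : ℝ)) *
        (1 / 2) ^ I.card.choose 2 := by
  simp only [edgesIn_eq]
  rw [graphPr_card_edges_le _ not_isDiag_of_mem_pairsIn, card_pairsIn]

lemma graphPr_edgesIn_and_of_disjoint {I J : Finset (Fin n)} (φ ψ : ℕ → Prop)
    (h : Disjoint I J) :
    graphPr (fun G => φ (edgesIn G I) ∧ ψ (edgesIn G J)) =
      graphPr (fun G => φ (edgesIn G I)) * graphPr (fun G => ψ (edgesIn G J)) :=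
  graphPr_and_of_disjoint (determinedBy_edgesIn I φ) (determinedBy_edgesIn J ψ)
    (by exact_mod_cast disjoint_pairsIn h)

lemma graphPr_edgesIn_and_le {κ q : ℕ} {p : ℝ} {I J : Finset (Fin n)} (φ : ℕ → Prop)
    (hφ : ∀ m, φ m → m ≤ q) (hJ : J.card = κ)
    (hp : graphPr (fun G => φ (edgesIn G I)) = p) (hp2 : (1 / 2) ^ κ.choose 2 ≤ p) :
    graphPr (fun G => φ (edgesIn G I) ∧ φ (edgesIn G J)) ≤
      ((κ.choose 2 + 1 : ℕ) : ℝ) ^ q * p ^ 2 *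
        (2 ^ (I ∩ J).card.choose 2 * 1 ^ (I ∩ J).card) := by
  set D := pairsIn J \ pairsIn I with hD
  have hDc : D.card + (I ∩ J).card.choose 2 = κ.choose 2 := by
    rw [← hJ, ← card_pairsIn, ← card_pairsIn, ← pairsIn_inter, Finset.inter_comm]
    exact Finset.card_sdiff_add_card_inter _ _
  have hp0 : 0 < p := lt_of_lt_of_le (by positivity) hp2
  calc _ ≤ graphPr (fun G => φ (edgesIn G I) ∧ (D.filter fun e => e ∈ G.edgeSet).card ≤ q) := by
        refine graphPr_mono fun G hG => ⟨hG.1, le_trans ?_ (hφ _ hG.2)⟩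
        rw [edgesIn_eq]
        exact Finset.card_le_card (Finset.filter_subset_filter _ Finset.sdiff_subset)
    _ = p * graphPr (fun G => (D.filter fun e => e ∈ G.edgeSet).card ≤ q) := by
        rw [← hp]
        refine graphPr_and_of_disjoint (determinedBy_edgesIn I φ)
          (determinedBy_edges D fun s => s.card ≤ q) ?_
        exact_mod_cast Finset.disjoint_sdiff
    _ = p * ((∑ i ∈ Finset.range (q + 1), (D.card.choose i : ℝ)) * (1 / 2) ^ D.card) := by
        rw [graphPr_card_edges_le]
        exact fun e he => not_isDiag_of_mem_pairsIn e (Finset.sdiff_subset he)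
    _ ≤ p * (((κ.choose 2 + 1 : ℕ) : ℝ) ^ q * (p * 2 ^ (I ∩ J).card.choose 2)) := by
        gcongr
        · calc (∑ i ∈ Finset.range (q + 1), (D.card.choose i : ℝ)) ≤ ((D.card + 1) ^ q : ℕ) := by
                exact_mod_cast sum_choose_le D.card q
            _ ≤ _ := by
                push_cast
                gcongr
                omega
        · calc ((1 : ℝ) / 2) ^ D.card
              = (1 / 2) ^ κ.choose 2 * 2 ^ (I ∩ J).card.choose 2 := by
                rw [← hDc, pow_add, mul_assoc, ← mul_pow]
                norm_num
            _ ≤ _ := by gcongr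
    _ = _ := by
        rw [one_pow]
        ring

lemma pow_half_choose_le {M q : ℕ} (hq : q ≤ M) :
    (1 / 2 : ℝ) ^ M ≤ M.choose q * (1 / 2) ^ M := by
  have : (1 : ℝ) ≤ M.choose q := by exact_mod_cast Nat.choose_pos hq
  exact le_mul_of_one_le_left (by positivity) this

lemma pow_half_sum_choose_le (M q : ℕ) :
    (1 / 2 : ℝ) ^ M ≤ (∑ i ∈ Finset.range (q + 1), (M.choose i : ℝ)) * (1 / 2) ^ M := by
  refine le_mul_of_one_le_left (by positivity) ?_
  have : (M.choose 0 : ℝ) ≤ ∑ i ∈ Finset.range (q + 1), (M.choose i : ℝ) :=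
    Finset.single_le_sum (f := fun i => (M.choose i : ℝ)) (fun _ _ => by positivity)
      (Finset.mem_range.2 (Nat.succ_pos q))
  simpa using this

/-- `I` is independent and none of its vertices is adjacent to both `u` and `v`. -/
def IndepNoCommon (u v : Fin n) (I : Finset (Fin n)) (G : SimpleGraph (Fin n)) : Prop :=
  edgesIn G I = 0 ∧ NoCommon u v I G

lemma graphPr_indep_noCommon {u v : Fin n} (huv : u ≠ v) {I J : Finset (Fin n)}
    (hu : u ∉ I ∪ J) (hv : v ∉ I ∪ J) :
    graphPr (fun G => IndepNoCommon u v I G ∧ IndepNoCommon u v J G) =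
      (1 / 2) ^ (pairsIn I ∪ pairsIn J).card * (3 / 4) ^ (I ∪ J).card := by
  have h0 : (fun G => IndepNoCommon u v I G ∧ IndepNoCommon u v J G) = fun G =>
      ((pairsIn I ∪ pairsIn J).filter fun e => e ∈ G.edgeSet) = ∅ ∧ NoCommon u v (I ∪ J) G := by
    funext G
    simp only [IndepNoCommon, edgesIn_eq, Finset.card_eq_zero, Finset.filter_union,
      Finset.union_eq_empty, NoCommon, Finset.mem_union, or_imp, forall_and]
    refine propext ?_
    tauto
  rw [h0, graphPr_and_of_disjoint (determinedBy_edges _ fun s => s = ∅)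
    (determinedBy_noCommon u v _), graphPr_noCommon huv _ hu hv,
    graphPr_edges_eq _ _ (Finset.empty_subset _)]
  · intro e he
    rcases Finset.mem_union.1 he with h | h <;> exact not_isDiag_of_mem_pairsIn e h
  · rw [Set.disjoint_left]
    rintro e he ⟨w, -, hw⟩
    rw [Finset.mem_union, not_or] at hu hv
    rw [Finset.mem_coe, Finset.mem_union] at he
    rcases hw with rfl | rfl <;> simp only [mk_mem_pairsIn] at he <;> tauto

lemma graphPr_indepNoCommon {u v : Fin n} (huv : u ≠ v) {I : Finset (Fin n)}
    (hu : u ∉ I) (hv : v ∉ I) :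
    graphPr (IndepNoCommon u v I) = (1 / 2) ^ I.card.choose 2 * (3 / 4) ^ I.card := by
  have := graphPr_indep_noCommon huv (I := I) (J := I) (by simpa using hu) (by simpa using hv)
  simpa [card_pairsIn] using this

lemma graphPr_indepNoCommon_and_eq {κ : ℕ} {u v : Fin n} (huv : u ≠ v) {I J : Finset (Fin n)}
    (hI : I.card = κ) (hJ : J.card = κ) (hu : u ∉ I ∪ J) (hv : v ∉ I ∪ J) :
    graphPr (fun G => IndepNoCommon u v I G ∧ IndepNoCommon u v J G) =
      ((1 / 2) ^ κ.choose 2 * (3 / 4) ^ κ) ^ 2 *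
        (2 ^ (I ∩ J).card.choose 2 * (4 / 3) ^ (I ∩ J).card) := by
  rw [graphPr_indep_noCommon huv hu hv]
  have h1 := card_pairsIn_union I J
  have h2 := Finset.card_union_add_card_inter I J
  rw [hI, hJ] at h1 h2
  have h3 : (1 / 2 : ℝ) ^ (pairsIn I ∪ pairsIn J).card =
      ((1 / 2) ^ κ.choose 2) ^ 2 * 2 ^ (I ∩ J).card.choose 2 := by
    rw [← pow_mul, mul_two, ← h1, pow_add, mul_assoc, ← mul_pow]
    norm_num
  have h4 : (3 / 4 : ℝ) ^ (I ∪ J).card =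
      ((3 / 4) ^ κ) ^ 2 * (4 / 3) ^ (I ∩ J).card := by
    rw [← pow_mul, mul_two, ← h2, pow_add, mul_assoc, ← mul_pow]
    norm_num
  rw [h3, h4]
  ring

/-- No set of at most `w` vertices meets all the independent `κ`-sets. -/
lemma graphPr_not_robust_indep_le {κ w : ℕ} {B : ℝ} (h : SmallOverlap κ n 1 B) :
    graphPr (fun G : SimpleGraph (Fin n) => ¬ ∀ U : Finset (Fin n), U.card ≤ w →
      ∃ I ∈ (Finset.univ : Finset (Fin n)).powersetCard κ, edgesIn G I = 0 ∧ Disjoint I U) ≤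
      (4 * w * κ + 8) * overlapRatio κ n 1 B 1 ((1 / 2) ^ κ.choose 2) := by
  have hp : ∀ I ∈ (Finset.univ : Finset (Fin n)).powersetCard κ,
      graphPr (fun G => edgesIn G I = 0) = (1 / 2) ^ κ.choose 2 := by
    intro I hI
    rw [graphPr_edgesIn_eq, (Finset.mem_powersetCard.1 hI).2]
    simp
  have := graphPr_not_robust_le (W := Finset.univ) (κ := κ) (w := w) (R := 1)
    (p := (1 / 2) ^ κ.choose 2) (b := 1) (B := B)
    (fun (I : Finset (Fin n)) G => edgesIn G I = 0)
    (by simpa using h) zero_le_one (by positivity) hp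
    (fun I hI J hJ hIJ => by
      rw [graphPr_edgesIn_and_of_disjoint (fun m => m = 0) (fun m => m = 0) hIJ, hp I hI, hp J hJ,
        sq])
    (fun I hI J hJ => by
      have := graphPr_edgesIn_and_le (q := 0) (fun m => m = 0) (fun m hm => hm.le)
        (Finset.mem_powersetCard.1 hJ).2 (hp I hI) le_rfl
      simpa using this)
  simpa using this

lemma graphPr_not_robust_indepNoCommon_le {κ w : ℕ} {B : ℝ} {S : Finset (Fin n)} {u v : Fin n}
    (h : SmallOverlap κ Sᶜ.card (4 / 3) B) (hu : u ∈ S) (hv : v ∈ S) (huv : u ≠ v) :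
    graphPr (fun G : SimpleGraph (Fin n) => ¬ ∀ U : Finset (Fin n), U.card ≤ w →
      ∃ I ∈ Sᶜ.powersetCard κ, IndepNoCommon u v I G ∧ Disjoint I U) ≤
      (4 * w * κ + 8) *
        overlapRatio κ Sᶜ.card (4 / 3) B 1 ((1 / 2) ^ κ.choose 2 * (3 / 4) ^ κ) := by
  have hnot : ∀ I ∈ Sᶜ.powersetCard κ, ∀ x ∈ S, x ∉ I := fun I hI x hx hxI =>
    (Finset.mem_compl.1 ((Finset.mem_powersetCard.1 hI).1 hxI)) hx
  have hpair : ∀ I ∈ Sᶜ.powersetCard κ, ∀ J ∈ Sᶜ.powersetCard κ,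
      graphPr (fun G => IndepNoCommon u v I G ∧ IndepNoCommon u v J G) =
      ((1 / 2) ^ κ.choose 2 * (3 / 4) ^ κ) ^ 2 *
        (2 ^ (I ∩ J).card.choose 2 * (4 / 3) ^ (I ∩ J).card) := fun I hI J hJ =>
    graphPr_indepNoCommon_and_eq huv (Finset.mem_powersetCard.1 hI).2
      (Finset.mem_powersetCard.1 hJ).2
      (by simp [hnot I hI u hu, hnot J hJ u hu]) (by simp [hnot I hI v hv, hnot J hJ v hv])
  refine graphPr_not_robust_le (IndepNoCommon u v) h zero_le_one (by positivity) ?_ ?_ ?_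
  · intro I hI
    rw [graphPr_indepNoCommon huv (hnot I hI u hu) (hnot I hI v hv),
      (Finset.mem_powersetCard.1 hI).2]
  · intro I hI J hJ hIJ
    rw [hpair I hI J hJ, Finset.disjoint_iff_inter_eq_empty.1 hIJ]
    simp
  · intro I hI J hJ
    rw [hpair I hI J hJ, one_mul]

lemma graphPr_few_edgesIn_le {κ q : ℕ} {B : ℝ} {W : Finset (Fin n)} (hq : q ≤ κ.choose 2)
    (h : SmallOverlap κ W.card 1 B) :
    graphPr (fun G => (((W.powersetCard κ).filter fun I => edgesIn G I = q).card : ℝ) ≤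
      W.card.choose κ * ((κ.choose 2).choose q * (1 / 2) ^ κ.choose 2) / 2) ≤
      4 * overlapRatio κ W.card 1 B (((κ.choose 2 + 1 : ℕ) : ℝ) ^ q)
        ((κ.choose 2).choose q * (1 / 2) ^ κ.choose 2) := by
  have hp : ∀ I ∈ W.powersetCard κ,
      graphPr (fun G => edgesIn G I = q) = (κ.choose 2).choose q * (1 / 2) ^ κ.choose 2 := by
    intro I hI
    rw [graphPr_edgesIn_eq, (Finset.mem_powersetCard.1 hI).2]
  have hle := pow_half_choose_le hq
  have hfew := graphPr_few_le (R := ((κ.choose 2 + 1 : ℕ) : ℝ) ^ q)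
    (fun (I : Finset (Fin n)) G => edgesIn G I = q) h (by positivity)
    (lt_of_lt_of_le (by positivity) hle) hp ?_ ?_
  · refine (graphPr_mono fun G hG => ?_).trans hfew
    refine le_trans (le_of_eq ?_) hG
    congr! 2
    ext I
    simp only [Finset.mem_filter]
  · intro I hI J hJ hIJ
    rw [graphPr_edgesIn_and_of_disjoint (fun m => m = q) (fun m => m = q) hIJ, hp I hI, hp J hJ,
      sq]
  · intro I hI J hJ
    exact graphPr_edgesIn_and_le (fun m => m = q) (fun m hm => hm.le)
      (Finset.mem_powersetCard.1 hJ).2 (hp I hI) hle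

/-- Sparse `κ`-sets are pairwise disjoint with high probability. -/
lemma graphPr_exists_overlap_le {κ q : ℕ} {B : ℝ} (h : SmallOverlap κ n 1 B) :
    graphPr (fun G : SimpleGraph (Fin n) => ∃ S T : Finset (Fin n), S.card = κ ∧ T.card = κ ∧
      S ≠ T ∧ ¬ Disjoint S T ∧ edgesIn G S ≤ q ∧ edgesIn G T ≤ q) ≤
      (n.choose κ * ((∑ i ∈ Finset.range (q + 1), ((κ.choose 2).choose i : ℝ)) *
        (1 / 2) ^ κ.choose 2)) ^ 2 * (((κ.choose 2 + 1 : ℕ) : ℝ) ^ q * κ * B *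
          (1 + 1 ^ κ * 2 ^ κ.choose 2 / n.choose κ)) := by
  have hp : ∀ I ∈ (Finset.univ : Finset (Fin n)).powersetCard κ,
      graphPr (fun G => edgesIn G I ≤ q) =
        (∑ i ∈ Finset.range (q + 1), ((κ.choose 2).choose i : ℝ)) * (1 / 2) ^ κ.choose 2 := by
    intro I hI
    rw [graphPr_edgesIn_le, (Finset.mem_powersetCard.1 hI).2]
  have h1 := sum_distinct_overlap_le (W := Finset.univ) (κ := κ) (b := 1) (B := B)
    (R := ((κ.choose 2 + 1 : ℕ) : ℝ) ^ q)
    (p := (∑ i ∈ Finset.range (q + 1), ((κ.choose 2).choose i : ℝ)) * (1 / 2) ^ κ.choose 2)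
    (fun (I : Finset (Fin n)) G => edgesIn G I ≤ q) (by simpa using h) (by positivity)
    (fun I hI J hJ => graphPr_edgesIn_and_le (fun m => m ≤ q) (fun m hm => hm)
      (Finset.mem_powersetCard.1 hJ).2 (hp I hI)
      (pow_half_sum_choose_le _ _))
  rw [Finset.card_univ, Fintype.card_fin] at h1
  refine le_trans (le_trans (graphPr_mono fun G hG => ?_) (graphPr_exists_le _ _)) h1
  obtain ⟨S, T, hS, hT, hne, hd, hSq, hTq⟩ := hG
  exact ⟨(S, T), by simp [Finset.mem_powersetCard, hS, hT, hne, hd], hSq, hTq⟩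

lemma mem_compl_pairsIn {S I : Finset (Fin n)} (hI : I ⊆ Sᶜ) :
    ∀ e ∈ pairsIn I, e ∈ (pairsIn S : Set (Sym2 (Fin n)))ᶜ := by
  intro e he he'
  have hd : Disjoint I S := Finset.disjoint_left.2 fun x hx => Finset.mem_compl.1 (hI hx)
  exact Finset.disjoint_left.1 (disjoint_pairsIn hd) he (by simpa using he')

/-- First moment over sparse `κ`-sets `S`, for events not depending on the edges inside `S`. -/
lemma graphPr_exists_edgesIn_and_le {κ : ℕ} {p ρ : ℝ} (φ : ℕ → Prop)
    (Q : Finset (Fin n) → SimpleGraph (Fin n) → Prop)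
    (hp : ∀ S : Finset (Fin n), S.card = κ → graphPr (fun G => φ (edgesIn G S)) = p)
    (hQ : ∀ S : Finset (Fin n), DeterminedBy (pairsIn S : Set (Sym2 (Fin n)))ᶜ (Q S))
    (hρ : ∀ S : Finset (Fin n), S.card = κ → graphPr (Q S) ≤ ρ) (hp0 : 0 ≤ p) :
    graphPr (fun G : SimpleGraph (Fin n) => ∃ S : Finset (Fin n), S.card = κ ∧
      φ (edgesIn G S) ∧ Q S G) ≤ n.choose κ * p * ρ := by
  calc _ ≤ graphPr (fun G => ∃ S ∈ (Finset.univ : Finset (Fin n)).powersetCard κ,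
        φ (edgesIn G S) ∧ Q S G) := by
        refine graphPr_mono fun G ⟨S, hS, h⟩ => ⟨S, ?_, h⟩
        simp [Finset.mem_powersetCard, hS]
    _ ≤ ∑ S ∈ (Finset.univ : Finset (Fin n)).powersetCard κ,
        graphPr (fun G => φ (edgesIn G S) ∧ Q S G) :=
        graphPr_exists_le _ fun S G => φ (edgesIn G S) ∧ Q S G
    _ ≤ ∑ S ∈ (Finset.univ : Finset (Fin n)).powersetCard κ, p * ρ := by
        refine Finset.sum_le_sum fun S hS => ?_
        have hS' := (Finset.mem_powersetCard.1 hS).2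
        rw [graphPr_and_of_disjoint (determinedBy_edgesIn S φ) (hQ S) disjoint_compl_right,
          hp S hS']
        exact mul_le_mul_of_nonneg_left (hρ S hS') hp0
    _ = _ := by
        simp
        ring

lemma determinedBy_robust {κ w : ℕ} (S : Finset (Fin n)) :
    DeterminedBy (pairsIn S : Set (Sym2 (Fin n)))ᶜ (fun G : SimpleGraph (Fin n) =>
      ∃ u ∈ S, ∃ v ∈ S, u ≠ v ∧ ¬ ∀ U : Finset (Fin n), U.card ≤ w →
        ∃ I ∈ Sᶜ.powersetCard κ, IndepNoCommon u v I G ∧ Disjoint I U) := by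
  intro G H h
  have key : ∀ u ∈ S, ∀ v ∈ S, ∀ I ∈ Sᶜ.powersetCard κ,
      (IndepNoCommon u v I G ↔ IndepNoCommon u v I H) := by
    intro u hu v hv I hI
    have hI' := (Finset.mem_powersetCard.1 hI).1
    refine and_congr ?_ (determinedBy_noCommon u v I G H ?_)
    · rw [edgesIn_congr fun e he => h e (mem_compl_pairsIn hI' e he)]
    · rintro e ⟨w, hw, hew⟩
      refine h e fun he => ?_
      have hwS := Finset.mem_compl.1 (hI' hw)
      rcases hew with rfl | rfl <;> simp [mk_mem_pairsIn, hwS] at he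
  constructor
  · rintro ⟨u, hu, v, hv, huv, hn⟩
    refine ⟨u, hu, v, hv, huv, fun hr => hn fun U hU => ?_⟩
    obtain ⟨I, hI, h1, h2⟩ := hr U hU
    exact ⟨I, hI, (key u hu v hv I hI).2 h1, h2⟩
  · rintro ⟨u, hu, v, hv, huv, hn⟩
    refine ⟨u, hu, v, hv, huv, fun hr => hn fun U hU => ?_⟩
    obtain ⟨I, hI, h1, h2⟩ := hr U hU
    exact ⟨I, hI, (key u hu v hv I hI).1 h1, h2⟩

lemma determinedBy_few {κ q : ℕ} (S : Finset (Fin n)) (x : ℝ) :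
    DeterminedBy (pairsIn S : Set (Sym2 (Fin n)))ᶜ (fun G : SimpleGraph (Fin n) =>
      (((Sᶜ.powersetCard κ).filter fun I => edgesIn G I = q).card : ℝ) ≤ x) := by
  intro G H h
  have : (Sᶜ.powersetCard κ).filter (fun I => edgesIn G I = q) =
      (Sᶜ.powersetCard κ).filter (fun I => edgesIn H I = q) := by
    refine Finset.filter_congr fun I hI => ?_
    rw [edgesIn_congr fun e he => h e (mem_compl_pairsIn (Finset.mem_powersetCard.1 hI).1 e he)]
  simp only [this]

/-- Every sparse `κ`-set has many independent `k`-sets avoiding the common neighbourhoods. -/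
lemma graphPr_exists_not_robust_le {κ k q w : ℕ} {B : ℝ}
    (h : SmallOverlap k (n - κ) (4 / 3) B) :
    graphPr (fun G : SimpleGraph (Fin n) => ∃ S : Finset (Fin n), S.card = κ ∧
      edgesIn G S ≤ q ∧ ∃ u ∈ S, ∃ v ∈ S, u ≠ v ∧ ¬ ∀ U : Finset (Fin n), U.card ≤ w →
        ∃ I ∈ Sᶜ.powersetCard k, IndepNoCommon u v I G ∧ Disjoint I U) ≤
      n.choose κ * ((∑ i ∈ Finset.range (q + 1), ((κ.choose 2).choose i : ℝ)) *
        (1 / 2) ^ κ.choose 2) * (κ ^ 2 * ((4 * w * k + 8) *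
        overlapRatio k (n - κ) (4 / 3) B 1 ((1 / 2) ^ k.choose 2 * (3 / 4) ^ k))) := by
  refine graphPr_exists_edgesIn_and_le (fun m => m ≤ q) _ (fun S hS => ?_)
    (fun S => determinedBy_robust S) (fun S hS => ?_) (by positivity)
  · rw [graphPr_edgesIn_le, hS]
  · have hc : Sᶜ.card = n - κ := by rw [Finset.card_compl, Fintype.card_fin, hS]
    calc _ ≤ graphPr (fun G : SimpleGraph (Fin n) => ∃ x ∈ S.offDiag,
          ¬ ∀ U : Finset (Fin n), U.card ≤ w →
          ∃ I ∈ Sᶜ.powersetCard k, IndepNoCommon x.1 x.2 I G ∧ Disjoint I U) := by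
          refine graphPr_mono fun G ⟨u, hu, v, hv, huv, hn⟩ => ⟨(u, v), ?_, hn⟩
          simp [hu, hv, huv]
      _ ≤ ∑ x ∈ S.offDiag, graphPr (fun G : SimpleGraph (Fin n) =>
          ¬ ∀ U : Finset (Fin n), U.card ≤ w →
          ∃ I ∈ Sᶜ.powersetCard k, IndepNoCommon x.1 x.2 I G ∧ Disjoint I U) :=
          graphPr_exists_le _ _
      _ ≤ ∑ x ∈ S.offDiag, ((4 * w * k + 8) *
          overlapRatio k (n - κ) (4 / 3) B 1 ((1 / 2) ^ k.choose 2 * (3 / 4) ^ k)) := by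
          refine Finset.sum_le_sum fun x hx => ?_
          rw [Finset.mem_offDiag] at hx
          rw [← hc]
          exact graphPr_not_robust_indepNoCommon_le (by rwa [hc]) hx.1 hx.2.1 hx.2.2
      _ = (S.offDiag.card : ℝ) * ((4 * w * k + 8) *
          overlapRatio k (n - κ) (4 / 3) B 1 ((1 / 2) ^ k.choose 2 * (3 / 4) ^ k)) := by
          rw [Finset.sum_const, nsmul_eq_mul]
      _ ≤ _ := by
          have h0 : 0 ≤ overlapRatio k (n - κ) (4 / 3) B 1
              ((1 / 2) ^ k.choose 2 * (3 / 4) ^ k) := by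
            have := h.2.2.2.1
            unfold overlapRatio
            positivity
          gcongr
          rw [Finset.offDiag_card, hS, sq]
          exact_mod_cast Nat.sub_le _ _

lemma graphPr_exists_few_le {κ q i : ℕ} {B : ℝ} (hq : q ≤ κ.choose 2)
    (h : SmallOverlap κ (n - κ) 1 B) :
    graphPr (fun G : SimpleGraph (Fin n) => ∃ S : Finset (Fin n), S.card = κ ∧
      edgesIn G S = i ∧ (((Sᶜ.powersetCard κ).filter fun I => edgesIn G I = q).card : ℝ) ≤
        (n - κ).choose κ * ((κ.choose 2).choose q * (1 / 2) ^ κ.choose 2) / 2) ≤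
      n.choose κ * ((κ.choose 2).choose i * (1 / 2) ^ κ.choose 2) *
      (4 * overlapRatio κ (n - κ) 1 B (((κ.choose 2 + 1 : ℕ) : ℝ) ^ q)
        ((κ.choose 2).choose q * (1 / 2) ^ κ.choose 2)) := by
  refine graphPr_exists_edgesIn_and_le (fun m => m = i)
    (fun S G => (((Sᶜ.powersetCard κ).filter fun I => edgesIn G I = q).card : ℝ) ≤
        (n - κ).choose κ * ((κ.choose 2).choose q * (1 / 2) ^ κ.choose 2) / 2)
    (fun S hS => ?_) (fun S => determinedBy_few S _) (fun S hS => ?_) (by positivity)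
  · rw [graphPr_edgesIn_eq, hS]
  · have hc : Sᶜ.card = n - κ := by rw [Finset.card_compl, Fintype.card_fin, hS]
    rw [← hc]
    exact graphPr_few_edgesIn_le hq (by rwa [hc])

lemma graphPr_le_numZ {κ i ξ : ℕ} (hξ : 1 ≤ ξ) :
    graphPr (fun G : SimpleGraph (Fin n) => ξ ≤ numZ n κ i G) ≤
      n.choose κ * ((κ.choose 2).choose i * (1 / 2) ^ κ.choose 2) := by
  calc _ ≤ graphPr (fun G : SimpleGraph (Fin n) => (1 : ℝ) ≤ (numZ n κ i G : ℝ)) := by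
        refine graphPr_mono fun G hG => ?_
        exact_mod_cast hξ.trans hG
    _ ≤ graphAvg (fun G => (numZ n κ i G : ℝ)) / 1 :=
        graphPr_markov _ (fun G => by positivity) one_pos
    _ = _ := by
        unfold numZ
        rw [div_one, graphAvg_card_filter _ (fun (S : Finset (Fin n)) G => edgesIn G S = i),
          Finset.sum_congr rfl fun S hS => by
            rw [graphPr_edgesIn_eq, (Finset.mem_powersetCard.1 hS).2]]
        simp

end Events

section Construction

variable {n : ℕ}

lemma exists_disjoint_family {ι α : Type*} {k w : ℕ} (P : ι → Finset α → Prop) (V : Finset α)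
    (s : Finset ι) (hw : V.card + s.card * k ≤ w)
    (h : ∀ e ∈ s, ∀ U : Finset α, U.card ≤ w → ∃ I : Finset α, I.card = k ∧ P e I ∧ Disjoint I U) :
    ∃ F : ι → Finset α, (∀ e ∈ s, (F e).card = k ∧ P e (F e) ∧ Disjoint (F e) V) ∧
      ∀ e ∈ s, ∀ f ∈ s, e ≠ f → Disjoint (F e) (F f) := by
  induction s using Finset.induction_on with
  | empty => exact ⟨fun _ => ∅, by simp, by simp⟩
  | insert a s ha ih =>
    rw [Finset.card_insert_of_notMem ha, add_mul, one_mul] at hw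
    obtain ⟨F, hF, hd⟩ := ih (by omega) fun e he => h e (Finset.mem_insert_of_mem he)
    have hc : (V ∪ s.biUnion F).card ≤ w := by
      have h1 := Finset.card_union_le V (s.biUnion F)
      have h2 : (s.biUnion F).card ≤ s.card * k :=
        Finset.card_biUnion_le_card_mul _ _ _ fun e he => (hF e he).1.le
      omega
    obtain ⟨I, hI, hP, hdI⟩ := h a (Finset.mem_insert_self _ _) _ hc
    rw [Finset.disjoint_union_right, Finset.disjoint_biUnion_right] at hdI
    have hne : ∀ e ∈ s, e ≠ a := fun e he hea => ha (hea ▸ he)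
    refine ⟨Function.update F a I, fun e he => ?_, fun e he f hf hef => ?_⟩
    · rcases Finset.mem_insert.1 he with rfl | he
      · simpa using ⟨hI, hP, hdI.1⟩
      · rw [Function.update_of_ne (hne e he)]
        exact hF e he
    · rcases Finset.mem_insert.1 he with rfl | he' <;>
        rcases Finset.mem_insert.1 hf with rfl | hf'
      · exact absurd rfl hef
      · rw [Function.update_self, Function.update_of_ne (hne f hf')]
        exact hdI.2 f hf'
      · rw [Function.update_self, Function.update_of_ne (hne e he')]
        exact (hdI.2 e he').symm
      · rw [Function.update_of_ne (hne f hf'), Function.update_of_ne (hne e he')]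
        exact hd e he' f hf' hef

lemma card_le_alphaClq {r : ℕ} {G : SimpleGraph (Fin n)} (U : Finset (Fin n))
    (h : ∀ Q ⊆ U, G.IsClique (Q : Set (Fin n)) → Q.card ≤ r) : U.card ≤ alphaClq n (r + 1) G := by
  refine le_csSup ⟨n, ?_⟩ ⟨U, rfl, ?_⟩
  · rintro m ⟨s, rfl, -⟩
    simpa using Finset.card_le_univ s
  · intro t ht
    have hc := h (t.map (Function.Embedding.subtype _)) (fun x hx => ?_) ?_
    · rw [Finset.card_map, ht.card_eq] at hc
      omega
    · obtain ⟨y, -, rfl⟩ := Finset.mem_map.1 hx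
      exact y.2
    · intro x hx y hy hxy
      rw [Finset.mem_coe, Finset.mem_map] at hx hy
      obtain ⟨x, hx, rfl⟩ := hx
      obtain ⟨y, hy, rfl⟩ := hy
      exact ht.isClique hx hy fun h => hxy (h ▸ rfl)

lemma card_clique_inter_le {G : SimpleGraph (Fin n)} {Q : Finset (Fin n)}
    (hQ : G.IsClique (Q : Set (Fin n))) (S : Finset (Fin n)) :
    (Q ∩ S).card ≤ 1 + (((pairsIn S).filter fun e => e ∈ G.edgeSet).filter
      fun e => ∀ v ∈ e, v ∈ Q).card := by
  have h1 : pairsIn (Q ∩ S) ⊆ ((pairsIn S).filter fun e => e ∈ G.edgeSet).filter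
      fun e => ∀ v ∈ e, v ∈ Q := by
    intro e he
    induction e with | _ u v
    rw [mk_mem_pairsIn, Finset.mem_inter, Finset.mem_inter] at he
    obtain ⟨⟨⟨hu, hu'⟩, hv, hv'⟩, huv⟩ := he
    simp only [Finset.mem_filter, mk_mem_pairsIn, SimpleGraph.mem_edgeSet, Sym2.mem_iff]
    refine ⟨⟨⟨⟨hu', hv'⟩, huv⟩, hQ hu hv huv⟩, ?_⟩
    rintro x (rfl | rfl) <;> assumption
  have h2 := Finset.card_le_card h1
  rw [card_pairsIn] at h2
  refine le_trans ?_ (Nat.add_le_add_left h2 1)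
  generalize (Q ∩ S).card = c
  rcases c with _ | _ | c
  · simp
  · simp
  · rw [Nat.choose_succ_succ, Nat.choose_one_right]
    omega

/-- Disjoint sparse `(k + 1)`-sets extend to a large set without cliques on `r + 1` vertices. -/
lemma le_alphaClq_of_family {k r : ℕ} {G : SimpleGraph (Fin n)} (𝓢 : Finset (Finset (Fin n)))
    (hdisj : ∀ S ∈ 𝓢, ∀ T ∈ 𝓢, S ≠ T → Disjoint S T) (hcard : ∀ S ∈ 𝓢, S.card = k + 1)
    (hsum : 𝓢.card + ∑ S ∈ 𝓢, edgesIn G S = r)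
    (hrob : ∀ S ∈ 𝓢, ∀ u ∈ S, ∀ v ∈ S, G.Adj u v → ∀ U : Finset (Fin n),
      U.card ≤ r * (k + 1) → ∃ I ∈ Sᶜ.powersetCard k, IndepNoCommon u v I G ∧ Disjoint I U) :
    k * r + 𝓢.card ≤ alphaClq n (r + 1) G := by
  set ES : Finset (Fin n) → Finset (Sym2 (Fin n)) :=
    fun S => (pairsIn S).filter fun e => e ∈ G.edgeSet with hES
  set E := 𝓢.biUnion ES with hE
  have hESd : ∀ S ∈ 𝓢, ∀ T ∈ 𝓢, S ≠ T → Disjoint (ES S) (ES T) := fun S hS T hT hST =>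
    Finset.disjoint_filter_filter (disjoint_pairsIn (hdisj S hS T hT hST))
  have hEcard : 𝓢.card + E.card = r := by
    rw [hE, Finset.card_biUnion hESd, ← hsum]
    simp only [edgesIn_eq, hES]
  set V := 𝓢.biUnion (fun S => S) with hV
  have hVcard : V.card = 𝓢.card * (k + 1) := by
    rw [hV, Finset.card_biUnion hdisj]
    exact Finset.sum_const_nat hcard
  obtain ⟨F, hF, hFd⟩ := exists_disjoint_family (k := k) (w := r * (k + 1))
    (fun (e : Sym2 (Fin n)) I => ∃ u v, e = s(u, v) ∧ IndepNoCommon u v I G) V E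
    (by rw [hVcard, ← hEcard]; nlinarith) (by
      intro e he U hU
      induction e with | _ u v
      rw [hE, Finset.mem_biUnion] at he
      obtain ⟨S, hS, he⟩ := he
      rw [hES, Finset.mem_filter, mk_mem_pairsIn] at he
      obtain ⟨I, hI, hP, hd⟩ := hrob S hS u he.1.1.1 v he.1.1.2 he.2 U hU
      exact ⟨I, (Finset.mem_powersetCard.1 hI).2, ⟨u, v, rfl, hP⟩, hd⟩)
  have hVF : Disjoint V (E.biUnion F) :=
    (Finset.disjoint_biUnion_right _ _ _).2 fun e he => (hF e he).2.2.symm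
  have hUcard : (V ∪ E.biUnion F).card = k * r + 𝓢.card := by
    rw [Finset.card_union_of_disjoint hVF, hVcard, Finset.card_biUnion hFd,
      Finset.sum_const_nat fun e he => (hF e he).1, ← hEcard]
    ring
  rw [← hUcard]
  refine card_le_alphaClq _ fun Q hQU hQ => ?_
  have h1 : ∀ e ∈ E, (Q ∩ F e).card + (if ∀ v ∈ e, v ∈ Q then 1 else 0) ≤ 1 := by
    intro e he
    obtain ⟨-, ⟨u, v, rfl, h0, hN⟩, hd⟩ := hF e he
    have h2 := card_clique_inter_le hQ (F s(u, v))
    rw [edgesIn_eq, Finset.card_eq_zero] at h0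
    rw [h0] at h2
    split_ifs with hin
    · rw [Nat.le_iff_lt_add_one, Nat.lt_succ_iff, add_le_iff_nonpos_left, Nat.le_zero,
        Finset.card_eq_zero, ← Finset.disjoint_iff_inter_eq_empty, Finset.disjoint_left]
      intro w hwQ hwF
      rw [hE, Finset.mem_biUnion] at he
      obtain ⟨S, hS, he⟩ := he
      rw [hES, Finset.mem_filter, mk_mem_pairsIn] at he
      have hne : ∀ x ∈ S, x ≠ w := by
        rintro x hx rfl
        exact Finset.disjoint_left.1 hd hwF (Finset.mem_biUnion.2 ⟨S, hS, hx⟩)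
      exact hN w hwF ⟨hQ (hin u (Sym2.mem_mk_left u v)) hwQ (hne u he.1.1.1),
        hQ (hin v (Sym2.mem_mk_right u v)) hwQ (hne v he.1.1.2)⟩
    · simpa using h2
  have h2 : (Q ∩ V).card ≤ 𝓢.card + (E.filter fun e => ∀ v ∈ e, v ∈ Q).card := by
    rw [hV, Finset.inter_biUnion, hE, Finset.filter_biUnion, Finset.card_biUnion
      fun S hS T hT hST => Finset.disjoint_filter_filter (hESd S hS T hT hST)]
    refine Finset.card_biUnion_le.trans ?_
    rw [Finset.card_eq_sum_ones, ← Finset.sum_add_distrib]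
    exact Finset.sum_le_sum fun S _ => card_clique_inter_le hQ S
  have h3 : (Q ∩ E.biUnion F).card + (E.filter fun e => ∀ v ∈ e, v ∈ Q).card ≤ E.card := by
    calc _ ≤ ∑ e ∈ E, (Q ∩ F e).card + ∑ e ∈ E, (if ∀ v ∈ e, v ∈ Q then 1 else 0) := by
          rw [Finset.inter_biUnion, Finset.card_filter]
          exact Nat.add_le_add_right Finset.card_biUnion_le _
      _ ≤ ∑ e ∈ E, 1 := by
          rw [← Finset.sum_add_distrib]
          exact Finset.sum_le_sum h1
      _ = E.card := by simp
  have h4 : Q.card ≤ (Q ∩ V).card + (Q ∩ E.biUnion F).card := by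
    refine le_trans (Finset.card_le_card ?_) (Finset.card_union_le _ _)
    rw [← Finset.inter_union_distrib_left]
    exact Finset.subset_inter subset_rfl hQU
  omega

lemma le_alphaClq_of_robust {k r : ℕ} {G : SimpleGraph (Fin n)}
    (h : ∀ U : Finset (Fin n), U.card ≤ r * (k + 1) →
      ∃ I ∈ (Finset.univ : Finset (Fin n)).powersetCard (k + 1),
        edgesIn G I = 0 ∧ Disjoint I U) :
    k * r + r ≤ alphaClq n (r + 1) G := by
  obtain ⟨F, hF, hFd⟩ := exists_disjoint_family (k := k + 1) (w := r * (k + 1))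
    (fun (_ : ℕ) I => edgesIn G I = 0) ∅ (Finset.range r) (by simp) (by
      intro e _ U hU
      obtain ⟨I, hI, hI0⟩ := h U hU
      exact ⟨I, (Finset.mem_powersetCard.1 hI).2, hI0⟩)
  have hinj : Set.InjOn F (Finset.range r : Set ℕ) := by
    intro e he f hf hef
    by_contra hne
    have hd := hFd e he f hf hne
    rw [← hef, Finset.disjoint_self_iff_empty, ← Finset.card_eq_zero, (hF e he).1] at hd
    omega
  have hc : ((Finset.range r).image F).card = r := by
    rw [Finset.card_image_of_injOn hinj, Finset.card_range]
  have h0 : ∀ S ∈ (Finset.range r).image F, edgesIn G S = 0 := by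
    intro S hS
    obtain ⟨e, he, rfl⟩ := Finset.mem_image.1 hS
    exact (hF e he).2.1
  have := le_alphaClq_of_family (k := k) (r := r) (G := G) ((Finset.range r).image F) ?_ ?_ ?_ ?_
  · rwa [hc] at this
  · intro S hS T hT hST
    obtain ⟨e, he, rfl⟩ := Finset.mem_image.1 hS
    obtain ⟨f, hf, rfl⟩ := Finset.mem_image.1 hT
    exact hFd e he f hf fun hef => hST (by rw [hef])
  · intro S hS
    obtain ⟨e, he, rfl⟩ := Finset.mem_image.1 hS
    exact (hF e he).1
  · rw [hc, Finset.sum_eq_zero h0, add_zero]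
  · intro S hS u hu v hv huv
    have hS0 := h0 S hS
    rw [edgesIn_eq, Finset.card_eq_zero, Finset.filter_eq_empty_iff] at hS0
    exact absurd huv (hS0 (mk_mem_pairsIn.2 ⟨⟨hu, hv⟩, huv.ne⟩))

lemma le_alphaClq_of_sparse {k r q j s : ℕ} {G : SimpleGraph (Fin n)} (hs : s < j)
    (hr : r = j * (q + 1) + s) (hZ : j - s ≤ numZ n (k + 1) q G)
    (hdisj : ∀ S T : Finset (Fin n), S.card = k + 1 → T.card = k + 1 → S ≠ T →
      edgesIn G S ≤ q + 1 → edgesIn G T ≤ q + 1 → Disjoint S T)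
    (hrob : ∀ S : Finset (Fin n), S.card = k + 1 → edgesIn G S ≤ q + 1 →
      ∀ u ∈ S, ∀ v ∈ S, u ≠ v → ∀ U : Finset (Fin n), U.card ≤ r * (k + 1) →
        ∃ I ∈ Sᶜ.powersetCard k, IndepNoCommon u v I G ∧ Disjoint I U)
    (hmany : ∀ S : Finset (Fin n), S.card = k + 1 → edgesIn G S = q →
      s ≤ ((Sᶜ.powersetCard (k + 1)).filter fun I => edgesIn G I = q + 1).card) :
    k * r + j ≤ alphaClq n (r + 1) G := by
  obtain ⟨A, hA, hAc⟩ := Finset.exists_subset_card_eq hZ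
  have hA' : ∀ S ∈ A, S.card = k + 1 ∧ edgesIn G S = q := fun S hS => by
    simpa [Finset.mem_powersetCard] using hA hS
  obtain ⟨S₀, hS₀⟩ := Finset.card_pos.1 (show 0 < A.card by omega)
  obtain ⟨B, hB, hBc⟩ := Finset.exists_subset_card_eq (hmany S₀ (hA' S₀ hS₀).1 (hA' S₀ hS₀).2)
  have hB' : ∀ S ∈ B, S.card = k + 1 ∧ edgesIn G S = q + 1 := fun S hS => by
    have := Finset.mem_filter.1 (hB hS)
    exact ⟨(Finset.mem_powersetCard.1 this.1).2, this.2⟩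
  have hAB : Disjoint A B := by
    rw [Finset.disjoint_left]
    intro S hSA hSB
    have h1 := (hA' S hSA).2
    have h2 := (hB' S hSB).2
    omega
  have hc : (A ∪ B).card = j := by
    rw [Finset.card_union_of_disjoint hAB]
    omega
  have hall : ∀ S ∈ A ∪ B, S.card = k + 1 ∧ edgesIn G S ≤ q + 1 := by
    intro S hS
    rcases Finset.mem_union.1 hS with h | h
    · exact ⟨(hA' S h).1, by rw [(hA' S h).2]; omega⟩
    · exact ⟨(hB' S h).1, (hB' S h).2.le⟩
  have := le_alphaClq_of_family (k := k) (r := r) (G := G) (A ∪ B)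
    (fun S hS T hT hST => hdisj S T (hall S hS).1 (hall T hT).1 hST (hall S hS).2 (hall T hT).2)
    (fun S hS => (hall S hS).1) ?_
    (fun S hS u hu v hv huv => hrob S (hall S hS).1 (hall S hS).2 u hu v hv huv.ne)
  · rwa [hc] at this
  · rw [hc, Finset.sum_union hAB, Finset.sum_const_nat fun S hS => (hA' S hS).2,
      Finset.sum_const_nat fun S hS => (hB' S hS).2, hAc, hBc, hr]
    obtain ⟨t, rfl⟩ := Nat.exists_eq_add_of_le hs.le
    rw [Nat.add_sub_cancel_left]
    ring

end Construction

section Regime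

/-- The numerical conditions on the parameters; here `x` is a small power of `n` and `l` is
`log n`. -/
structure Regime (n k r : ℕ) (x l : ℝ) : Prop where
  one_le_k : 1 ≤ k
  one_le_r : 1 ≤ r
  r_le_k : r ≤ k
  x_pos : 0 < x
  l_pos : 0 < l
  x_pow : x ^ 200 = n
  k_le : 1000 * (k + 1 : ℝ) ^ 6 ≤ x
  l_le : 10 * l ≤ x
  le_two_pow : x ^ 399 ≤ 2 ^ k
  two_pow_le : 2 ^ (k + 1) ≤ x ^ 400
  pow_le : (((k + 1).choose 2 + 1 : ℕ) : ℝ) ^ r ≤ x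
  le_choose : 16 * (r : ℝ) ^ 2 * l + r ≤ (k + 1).choose 2

lemma choose_le_two_mul_choose_sub {n a κ : ℕ} (ha : a ≤ κ) (h : 4 * κ ^ 2 ≤ n) :
    (n.choose a : ℝ) ≤ 2 * (n - κ).choose a := by
  rcases Nat.eq_zero_or_pos κ with rfl | hκ
  · obtain rfl : a = 0 := by omega
    simp
  have hn : (0 : ℝ) < n := by
    exact_mod_cast lt_of_lt_of_le (by positivity) h
  have hκn : 2 * κ ≤ n := by nlinarith
  have h' : 4 * (κ : ℝ) ^ 2 ≤ n := by exact_mod_cast h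
  have hfac : (0 : ℝ) < a.factorial := by exact_mod_cast a.factorial_pos
  have h1 : (n.choose a : ℝ) * a.factorial ≤ (n : ℝ) ^ a := by
    rw [mul_comm]
    exact_mod_cast (Nat.descFactorial_eq_factorial_mul_choose n a) ▸ Nat.descFactorial_le_pow n a
  have h2 : ((n : ℝ) - 2 * κ) ^ a ≤ (n - κ).choose a * a.factorial := by
    have h3 : (n - κ + 1 - a) ^ a ≤ a.factorial * (n - κ).choose a :=
      (Nat.descFactorial_eq_factorial_mul_choose (n - κ) a) ▸
        Nat.pow_sub_le_descFactorial (n - κ) a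
    have h4 : (n - 2 * κ) ^ a ≤ (n - κ + 1 - a) ^ a := Nat.pow_le_pow_left (by omega) a
    have h5 : (((n - 2 * κ : ℕ) : ℝ)) ^ a ≤ (a.factorial : ℝ) * (n - κ).choose a := by
      exact_mod_cast h4.trans h3
    rw [Nat.cast_sub hκn] at h5
    push_cast at h5
    linarith
  have h3 : (1 : ℝ) / 2 ≤ (1 - 2 * κ / n) ^ a := by
    have h4 : (2 * κ / n : ℝ) ≤ 1 := by
      rw [div_le_one hn]
      exact_mod_cast hκn
    have h5 := one_add_mul_le_pow (a := -(2 * κ / n : ℝ)) (by linarith) a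
    have h6 : (a : ℝ) * (2 * κ / n) ≤ 1 / 2 := by
      rw [mul_div_assoc', div_le_iff₀ hn]
      have : (a : ℝ) ≤ κ := by exact_mod_cast ha
      nlinarith [Nat.cast_nonneg (α := ℝ) κ]
    rw [← sub_eq_add_neg] at h5
    linarith
  have h4 : (n : ℝ) ^ a ≤ 2 * ((n : ℝ) - 2 * κ) ^ a := by
    have : (n : ℝ) - 2 * κ = n * (1 - 2 * κ / n) := by field_simp
    rw [this, mul_pow]
    nlinarith [pow_pos hn a]
  have h5 : (n.choose a : ℝ) * a.factorial ≤ (2 * (n - κ).choose a) * a.factorial := by linarith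
  exact le_of_mul_le_mul_right h5 hfac

namespace Regime

variable {n k r : ℕ} {x l : ℝ}

lemma x_ge (h : Regime n k r x l) : 1000 ≤ x := by
  have h1 : (1 : ℝ) ≤ (k + 1 : ℝ) ^ 6 := one_le_pow₀ (by linarith [Nat.cast_nonneg (α := ℝ) k])
  linarith [h.k_le]

lemma succ_le (h : Regime n k r x l) : 1000 * (k + 1 : ℝ) ≤ x := by
  have h1 : (k + 1 : ℝ) ≤ (k + 1 : ℝ) ^ 6 :=
    le_self_pow₀ (by linarith [Nat.cast_nonneg (α := ℝ) k]) (by norm_num)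
  linarith [h.k_le]

lemma four_mul_sq_le (h : Regime n k r x l) : 4 * (k + 1) ^ 2 ≤ n := by
  have h1 : (k + 1 : ℝ) ^ 2 ≤ (k + 1 : ℝ) ^ 6 :=
    pow_le_pow_right₀ (by linarith [Nat.cast_nonneg (α := ℝ) k]) (by norm_num)
  have h2 : x ≤ x ^ 200 := le_self_pow₀ (by linarith [h.x_ge]) (by norm_num)
  have h3 : (4 * (k + 1) ^ 2 : ℝ) ≤ n := by
    rw [← h.x_pow]
    nlinarith [h.k_le, sq_nonneg (k + 1 : ℝ)]
  exact_mod_cast h3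

lemma succ_le_n (h : Regime n k r x l) : k + 1 ≤ n := by
  nlinarith [h.four_mul_sq_le]

lemma smallOverlap (h : Regime n k r x l) {a N : ℕ} {b : ℝ} (ha : k ≤ a) (ha' : a ≤ k + 1)
    (hN : N ≤ n) (hN' : n ≤ N + (k + 1)) (hb : 1 ≤ b) (hb' : b ≤ 4 / 3) :
    SmallOverlap a N b (x⁻¹ ^ 80) := by
  have hx := h.x_ge
  have hx0 := h.x_pos
  have hk := h.succ_le
  have h200 : x ≤ x ^ 200 / 1000 := by
    have : x ^ 2 ≤ x ^ 200 := pow_le_pow_right₀ (by linarith) (by norm_num)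
    nlinarith
  have haR : (a : ℝ) ≤ k + 1 := by exact_mod_cast ha'
  have hNR : (N : ℝ) ≤ x ^ 200 := by
    rw [h.x_pow]
    exact_mod_cast hN
  have hNR' : x ^ 200 ≤ N + (k + 1) := by
    rw [h.x_pow]
    exact_mod_cast hN'
  have hNa : x ^ 200 / 2 ≤ (N : ℝ) - a := by linarith
  have ha1 : 1 ≤ a := h.one_le_k.trans ha
  refine ⟨ha1, ?_, hb, by positivity, pow_le_one₀ (by positivity) (inv_le_one_of_one_le₀
    (by linarith)), ((2 : ℝ) ^ a) ^ (1 / 4 : ℝ), by positivity, ?_, ?_, ?_⟩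
  · have : (0 : ℝ) < (N : ℝ) - a := lt_of_lt_of_le (by positivity) hNa
    exact_mod_cast sub_pos.1 this
  · rw [← Real.rpow_natCast, ← Real.rpow_mul (by positivity)]
    norm_num
  all_goals
    have hy4 : (((2 : ℝ) ^ a) ^ (1 / 4 : ℝ)) ^ 4 = 2 ^ a := by
      rw [← Real.rpow_natCast, ← Real.rpow_mul (by positivity)]
      norm_num
    set y := ((2 : ℝ) ^ a) ^ (1 / 4 : ℝ)
    have hy0 : 0 ≤ y := by positivity
    have hy : y ≤ x ^ 100 := by
      refine le_of_pow_le_pow_left₀ (n := 4) (by norm_num) (by positivity) ?_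
      rw [hy4, ← pow_mul]
      exact (pow_le_pow_right₀ (by norm_num) ha').trans h.two_pow_le
  · have h3 : (a : ℝ) ^ 3 * b ≤ x / 2 := by
      have h4 : (a : ℝ) ^ 3 ≤ (k + 1 : ℝ) ^ 6 := by
        calc (a : ℝ) ^ 3 ≤ (k + 1 : ℝ) ^ 3 := by gcongr
          _ ≤ _ := pow_le_pow_right₀ (by linarith [Nat.cast_nonneg (α := ℝ) k]) (by norm_num)
      nlinarith [h.k_le, pow_nonneg (Nat.cast_nonneg (α := ℝ) a) 3]
    calc (a : ℝ) ^ 3 * y * b = (a ^ 3 * b) * y := by ring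
      _ ≤ x / 2 * x ^ 100 := by gcongr
      _ = x ^ 101 * 1 / 2 := by ring
      _ ≤ x ^ 101 * x ^ 19 / 2 := by
          gcongr
          exact one_le_pow₀ (by linarith)
      _ = x⁻¹ ^ 80 * (x ^ 200 / 2) := by
          field_simp
      _ ≤ _ := by gcongr
  · calc 2 * (a : ℝ) * N * y ≤ x * x ^ 200 * x ^ 100 := by
          gcongr
          linarith
      _ = x ^ 301 * 1 := by ring
      _ ≤ x ^ 301 * x ^ 18 := by
          gcongr
          exact one_le_pow₀ (by linarith)
      _ = x⁻¹ ^ 80 * x ^ 399 := by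
          field_simp
      _ ≤ _ := by
          gcongr
          exact h.le_two_pow.trans (pow_le_pow_right₀ (by norm_num) ha)

lemma inv_pow_le (h : Regime n k r x l) {a b : ℕ} (hab : a ≤ b) : x⁻¹ ^ b ≤ x⁻¹ ^ a :=
  pow_le_pow_of_le_one (inv_nonneg.2 h.x_pos.le) (inv_le_one_of_one_le₀ (by linarith [h.x_ge])) hab

lemma inv_le (h : Regime n k r x l) : x⁻¹ ≤ 1 / (10 * l) := by
  rw [inv_eq_one_div]
  exact one_div_le_one_div_of_le (by linarith [h.l_pos]) h.l_le

lemma poly_mul_inv_le (h : Regime n k r x l) : 1000 * (k + 1 : ℝ) ^ 6 * x⁻¹ ≤ 1 := by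
  rw [mul_inv_le_iff₀ h.x_pos, one_mul]
  exact h.k_le

lemma factor_le (h : Regime n k r x l) {a : ℕ} (ha : a ≤ k + 1) :
    4 * ((r * (k + 1) : ℕ) : ℝ) * a + 8 ≤ 5 * (k + 1 : ℝ) ^ 3 := by
  have h1 : (r : ℝ) ≤ k + 1 := by
    exact_mod_cast h.r_le_k.trans (Nat.le_succ k)
  have h2 : (a : ℝ) ≤ k + 1 := by exact_mod_cast ha
  have h3 : (2 : ℝ) ≤ k + 1 := by exact_mod_cast Nat.succ_le_succ h.one_le_k
  have h4 : (2 : ℝ) ^ 3 ≤ (k + 1 : ℝ) ^ 3 := by gcongr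
  calc 4 * ((r * (k + 1) : ℕ) : ℝ) * a + 8 ≤ 4 * ((k + 1) * (k + 1)) * (k + 1) + 8 := by
        push_cast
        gcongr
    _ ≤ _ := by nlinarith

lemma robust_indep_bound (h : Regime n k r x l)
    (hE : x ^ 20 ≤ n.choose (k + 1) * (1 / 2) ^ (k + 1).choose 2) :
    (4 * ((r * (k + 1) : ℕ) : ℝ) * ((k + 1 : ℕ) : ℝ) + 8) *
      overlapRatio (k + 1) n 1 (x⁻¹ ^ 80) 1 ((1 / 2) ^ (k + 1).choose 2) ≤ 1 / l := by
  have hx0 := h.x_pos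
  have hl := h.l_pos
  have hc : (1 : ℝ) ≤ k + 1 := by linarith [Nat.cast_nonneg (α := ℝ) k]
  set E := (n.choose (k + 1) : ℝ) * (1 / 2) ^ (k + 1).choose 2 with hEdef
  have hE0 : 0 < E := lt_of_lt_of_le (by positivity) hE
  have h1 : 1 / E ≤ x⁻¹ ^ 20 := by
    rw [inv_pow, ← one_div]
    exact one_div_le_one_div_of_le (by positivity) hE
  have h2 : (1 : ℝ) ^ (k + 1) * 2 ^ (k + 1).choose 2 / n.choose (k + 1) = 1 / E := by
    rw [hEdef, one_div_pow]
    field_simp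
    simp
  have h3 : x⁻¹ ^ 20 ≤ 1 := pow_le_one₀ (by positivity)
    (inv_le_one_of_one_le₀ (by linarith [h.x_ge]))
  have h4 : x⁻¹ ^ 80 ≤ x⁻¹ ^ 20 := h.inv_pow_le (by norm_num)
  unfold overlapRatio
  rw [h2, ← hEdef]
  calc _ ≤ 5 * (k + 1 : ℝ) ^ 3 * (x⁻¹ ^ 20 + 1 * (k + 1 : ℝ) * x⁻¹ ^ 20 * (1 + 1)) := by
        have := h.factor_le le_rfl
        push_cast at this ⊢
        gcongr
        exact h1.trans h3
    _ ≤ 5 * (k + 1 : ℝ) ^ 3 * (x⁻¹ ^ 20 * (3 * (k + 1))) := by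
        gcongr
        have : 0 ≤ x⁻¹ ^ 20 := by positivity
        nlinarith
    _ = 15 * (k + 1 : ℝ) ^ 4 * x⁻¹ * x⁻¹ ^ 19 := by ring
    _ ≤ 1000 * (k + 1 : ℝ) ^ 6 * x⁻¹ * x⁻¹ ^ 1 := by
        gcongr ?_ * x⁻¹ * ?_
        · have : (k + 1 : ℝ) ^ 4 ≤ (k + 1 : ℝ) ^ 6 := pow_le_pow_right₀ hc (by norm_num)
          nlinarith [pow_pos (show (0 : ℝ) < k + 1 by linarith) 6]
        · exact h.inv_pow_le (by norm_num)
    _ ≤ 1 * x⁻¹ ^ 1 := by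
        gcongr
        exact h.poly_mul_inv_le
    _ ≤ 1 / (10 * l) := by
        rw [one_mul, pow_one]
        exact h.inv_le
    _ ≤ _ := one_div_le_one_div_of_le hl (by linarith)

end Regime

end Regime

section SparseRegime

namespace Regime

variable {n k r q : ℕ} {x l : ℝ}

lemma pow_le_x (h : Regime n k r x l) (hq : q ≤ r) :
    (((k + 1).choose 2 + 1 : ℕ) : ℝ) ^ q ≤ x := by
  refine (pow_le_pow_right₀ ?_ hq).trans h.pow_le
  exact_mod_cast Nat.succ_pos _

lemma sum_choose_le_x (h : Regime n k r x l) (hq : q ≤ r) :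
    ∑ i ∈ Finset.range (q + 1), (((k + 1).choose 2).choose i : ℝ) ≤ x := by
  refine le_trans ?_ (h.pow_le_x hq)
  exact_mod_cast sum_choose_le ((k + 1).choose 2) q

lemma choose_le_x (h : Regime n k r x l) (hq : q ≤ r) :
    (((k + 1).choose 2).choose q : ℝ) ≤ x :=
  (Finset.single_le_sum (f := fun i => (((k + 1).choose 2).choose i : ℝ))
    (fun _ _ => by positivity) (Finset.mem_range.2 (Nat.lt_succ_self q))).trans
    (h.sum_choose_le_x hq)

lemma inv_sq_le (h : Regime n k r x l) (hq : q ≤ r) {E : ℝ} (hE : 0 ≤ E)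
    (hm : 1 / l ≤ E * ((k + 1).choose 2).choose q) : x⁻¹ ^ 2 ≤ E := by
  have hx := h.x_pos
  have h1 : x⁻¹ ≤ E * x := by
    calc x⁻¹ ≤ 1 / (10 * l) := h.inv_le
      _ ≤ 1 / l := one_div_le_one_div_of_le h.l_pos (by linarith [h.l_pos])
      _ ≤ _ := hm
      _ ≤ E * x := by
        gcongr
        exact h.choose_le_x hq
  rw [sq, ← div_eq_mul_inv, div_le_iff₀ hx]
  exact h1

lemma overlap_bound (h : Regime n k r x l) (hq : q ≤ r)
    (hE : n.choose (k + 1) * (1 / 2 : ℝ) ^ (k + 1).choose 2 ≤ x ^ 20) :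
    (n.choose (k + 1) * ((∑ i ∈ Finset.range (q + 1), (((k + 1).choose 2).choose i : ℝ)) *
      (1 / 2) ^ (k + 1).choose 2)) ^ 2 * ((((k + 1).choose 2 + 1 : ℕ) : ℝ) ^ q *
        ((k + 1 : ℕ) : ℝ) * x⁻¹ ^ 80 *
          (1 + 1 ^ (k + 1) * 2 ^ (k + 1).choose 2 / n.choose (k + 1))) ≤ x⁻¹ := by
  have hx := h.x_pos
  have hC : (0 : ℝ) < n.choose (k + 1) := by exact_mod_cast Nat.choose_pos h.succ_le_n
  set E := (n.choose (k + 1) : ℝ) * (1 / 2) ^ (k + 1).choose 2 with hEdef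
  have hE0 : 0 < E := by positivity
  have h2 : (1 : ℝ) ^ (k + 1) * 2 ^ (k + 1).choose 2 / n.choose (k + 1) = 1 / E := by
    rw [hEdef, one_div_pow]
    field_simp
    simp
  have hx20 : x ^ 20 ≤ x ^ 40 := pow_le_pow_right₀ (by linarith [h.x_ge]) (by norm_num)
  have hE2 : E ^ 2 ≤ x ^ 40 := by
    calc E ^ 2 ≤ (x ^ 20) ^ 2 := by gcongr
      _ = x ^ 40 := by ring
  rw [h2, mul_left_comm (n.choose (k + 1) : ℝ), ← hEdef]
  calc _ ≤ (x * E) ^ 2 * (x * (k + 1 : ℝ) * x⁻¹ ^ 80 * (1 + 1 / E)) := by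
        push_cast
        have h3 := h.pow_le_x hq
        push_cast at h3
        gcongr
        exact h.sum_choose_le_x hq
    _ = x ^ 3 * (k + 1) * x⁻¹ ^ 80 * (E ^ 2 + E) := by
        field_simp
    _ ≤ x ^ 3 * (k + 1) * x⁻¹ ^ 80 * (x ^ 40 + x ^ 40) := by
        gcongr
        exact hE.trans hx20
    _ = 2 * (k + 1) * x⁻¹ ^ 37 := by
        field_simp
        ring
    _ ≤ x * x⁻¹ ^ 2 := by
        gcongr ?_ * ?_
        · linarith [h.succ_le]
        · exact h.inv_pow_le (by norm_num)
    _ = x⁻¹ := by field_simp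

lemma three_quarters_pow_le (h : Regime n k r x l) : (4 / 3 : ℝ) ^ k ≤ x ^ 167 := by
  have hx := h.x_pos
  refine le_of_pow_le_pow_left₀ (n := 12) (by norm_num) (by positivity) ?_
  calc ((4 / 3 : ℝ) ^ k) ^ 12 = ((4 / 3 : ℝ) ^ 12) ^ k := by rw [← pow_mul, ← pow_mul, mul_comm]
    _ ≤ (2 ^ 5) ^ k := by gcongr; norm_num
    _ = (2 ^ k) ^ 5 := by rw [← pow_mul, ← pow_mul, mul_comm]
    _ ≤ (x ^ 400) ^ 5 := by
        gcongr
        exact (pow_le_pow_right₀ (by norm_num) (Nat.le_succ k)).trans h.two_pow_le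
    _ = x ^ 2000 := by rw [← pow_mul]
    _ ≤ x ^ 2004 := pow_le_pow_right₀ (by linarith [h.x_ge]) (by norm_num)
    _ = _ := by rw [← pow_mul]

lemma one_div_le_of_indepNoCommon (h : Regime n k r x l)
    (hE : x⁻¹ ^ 2 ≤ n.choose (k + 1) * (1 / 2 : ℝ) ^ (k + 1).choose 2) :
    1 / ((n - (k + 1)).choose k * ((1 / 2 : ℝ) ^ k.choose 2 * (3 / 4) ^ k)) ≤ 2 * x⁻¹ ^ 30 := by
  have hx := h.x_pos
  set h0 : ℝ := (1 / 2) ^ (k + 1).choose 2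
  have hh0 : 0 < h0 := by positivity
  have h1 := choose_le_two_mul_choose_sub (Nat.le_succ k) h.four_mul_sq_le
  have h2 : (n.choose (k + 1) : ℝ) ≤ n.choose k * x ^ 200 := by
    rw [h.x_pow]
    have h3 := Nat.choose_succ_right_eq n k
    have h4 : n.choose (k + 1) ≤ n.choose k * n :=
      calc n.choose (k + 1) ≤ n.choose (k + 1) * (k + 1) := Nat.le_mul_of_pos_right _ k.succ_pos
        _ = n.choose k * (n - k) := h3
        _ ≤ _ := Nat.mul_le_mul_left _ (Nat.sub_le _ _)
    exact_mod_cast h4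
  have h3 : (1 / 2 : ℝ) ^ k.choose 2 = h0 * 2 ^ k := by
    have : (k + 1).choose 2 = k.choose 2 + k := by
      rw [Nat.choose_succ_succ' k 1, Nat.choose_one_right, add_comm]
    rw [show h0 = (1 / 2 : ℝ) ^ (k.choose 2 + k) by rw [← this], pow_add, mul_assoc, ← mul_pow]
    norm_num
  have h4 : 1 ≤ (3 / 4 : ℝ) ^ k * x ^ 167 := by
    calc (1 : ℝ) = (3 / 4) ^ k * (4 / 3) ^ k := by rw [← mul_pow]; norm_num
      _ ≤ _ := by
        gcongr
        exact h.three_quarters_pow_le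
  rw [h3]
  set N := ((n - (k + 1)).choose k : ℝ)
  have h5 : x ^ 397 ≤ 2 * x ^ 367 * (N * (h0 * 2 ^ k * (3 / 4) ^ k)) := by
    calc x ^ 397 = x⁻¹ ^ 2 * x ^ 399 * 1 := by field_simp
      _ ≤ (n.choose (k + 1) * h0) * 2 ^ k * ((3 / 4 : ℝ) ^ k * x ^ 167) := by
          gcongr
          exact h.le_two_pow
      _ ≤ (2 * N * x ^ 200 * h0) * 2 ^ k * ((3 / 4 : ℝ) ^ k * x ^ 167) := by
          gcongr
          exact h2.trans (by gcongr)
      _ = _ := by ring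
  have h6 : x ^ 30 ≤ 2 * (N * (h0 * 2 ^ k * (3 / 4) ^ k)) := by
    refine le_of_mul_le_mul_left ?_ (pow_pos hx 367)
    calc x ^ 367 * x ^ 30 = x ^ 397 := by rw [← pow_add]
      _ ≤ _ := h5
      _ = _ := by ring
  rw [div_le_iff₀ (by linarith [pow_pos hx 30])]
  calc (1 : ℝ) = x⁻¹ ^ 30 * x ^ 30 := by field_simp
    _ ≤ x⁻¹ ^ 30 * (2 * (N * (h0 * 2 ^ k * (3 / 4) ^ k))) := by gcongr
    _ = _ := by ring

lemma robust_bound (h : Regime n k r x l) (hq : q ≤ r)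
    (hE : n.choose (k + 1) * (1 / 2 : ℝ) ^ (k + 1).choose 2 ≤ x ^ 20)
    (hE' : x⁻¹ ^ 2 ≤ n.choose (k + 1) * (1 / 2 : ℝ) ^ (k + 1).choose 2) :
    n.choose (k + 1) * ((∑ i ∈ Finset.range (q + 1), (((k + 1).choose 2).choose i : ℝ)) *
      (1 / 2) ^ (k + 1).choose 2) * (((k + 1 : ℕ) : ℝ) ^ 2 *
        ((4 * ((r * (k + 1) : ℕ) : ℝ) * k + 8) * overlapRatio k (n - (k + 1)) (4 / 3) (x⁻¹ ^ 80) 1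
          ((1 / 2) ^ k.choose 2 * (3 / 4) ^ k))) ≤ x⁻¹ := by
  have hx := h.x_pos
  have hc : (1 : ℝ) ≤ k + 1 := by linarith [Nat.cast_nonneg (α := ℝ) k]
  have h1 := h.one_div_le_of_indepNoCommon hE'
  set X := ((n - (k + 1)).choose k : ℝ) * ((1 / 2 : ℝ) ^ k.choose 2 * (3 / 4) ^ k) with hX
  have h2 : (4 / 3 : ℝ) ^ k * 2 ^ k.choose 2 / (n - (k + 1)).choose k = 1 / X := by
    rw [hX, one_div_pow, show (4 / 3 : ℝ) = (3 / 4)⁻¹ by norm_num, inv_pow]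
    field_simp
  have h3 : x⁻¹ ^ 30 ≤ 1 := pow_le_one₀ (by positivity)
    (inv_le_one_of_one_le₀ (by linarith [h.x_ge]))
  have h4 : x⁻¹ ^ 80 ≤ x⁻¹ ^ 30 := h.inv_pow_le (by norm_num)
  have hr : overlapRatio k (n - (k + 1)) (4 / 3) (x⁻¹ ^ 80) 1
      ((1 / 2) ^ k.choose 2 * (3 / 4) ^ k) ≤ 5 * (k + 1) * x⁻¹ ^ 30 := by
    unfold overlapRatio
    rw [h2, ← hX]
    calc _ ≤ 2 * x⁻¹ ^ 30 + 1 * k * x⁻¹ ^ 30 * (1 + 2 * 1) := by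
          gcongr
          exact h1.trans (by gcongr)
      _ ≤ _ := by
          have : 0 ≤ x⁻¹ ^ 30 := by positivity
          nlinarith
  rw [mul_left_comm (n.choose (k + 1) : ℝ)]
  have hr0 : 0 ≤ overlapRatio k (n - (k + 1)) (4 / 3) (x⁻¹ ^ 80) 1
      ((1 / 2) ^ k.choose 2 * (3 / 4) ^ k) := by
    unfold overlapRatio
    positivity
  calc _ ≤ x * x ^ 20 * ((k + 1 : ℝ) ^ 2 * ((5 * (k + 1 : ℝ) ^ 3) *
        (5 * (k + 1) * x⁻¹ ^ 30))) := by
        have h5 := h.factor_le (Nat.le_succ k)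
        have h6 := h.sum_choose_le_x hq
        push_cast at h5 ⊢
        gcongr
    _ = 25 * (k + 1) ^ 6 * x⁻¹ * x⁻¹ ^ 8 := by
        field_simp
        ring
    _ ≤ 1000 * (k + 1 : ℝ) ^ 6 * x⁻¹ * x⁻¹ ^ 1 := by
        gcongr ?_ * _ * _ * ?_
        · norm_num
        · exact h.inv_pow_le (by norm_num)
    _ ≤ 1 * x⁻¹ ^ 1 := by
        gcongr
        exact h.poly_mul_inv_le
    _ = x⁻¹ := by ring

lemma succ_le_choose (h : Regime n k r x l) (hq : q + 1 ≤ r) : q + 1 ≤ (k + 1).choose 2 := by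
  have h1 := h.le_choose
  have h2 : (0 : ℝ) ≤ 16 * (r : ℝ) ^ 2 * l := by
    have := h.l_pos
    positivity
  have h3 : r ≤ (k + 1).choose 2 := by
    exact_mod_cast (show (r : ℝ) ≤ (k + 1).choose 2 by linarith)
  exact hq.trans h3

lemma many_mean_le (h : Regime n k r x l) (hq : q + 1 ≤ r) :
    8 * r * l * (n.choose (k + 1) *
      (((k + 1).choose 2).choose q * (1 / 2 : ℝ) ^ (k + 1).choose 2)) ≤
      (n - (k + 1)).choose (k + 1) *
        (((k + 1).choose 2).choose (q + 1) * (1 / 2) ^ (k + 1).choose 2) := by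
  have h1 := choose_le_two_mul_choose_sub le_rfl h.four_mul_sq_le
  have hr : (1 : ℝ) ≤ r := by exact_mod_cast h.one_le_r
  have hl := h.l_pos
  have h2 : 16 * (r : ℝ) * l * ((k + 1).choose 2).choose q ≤
      ((k + 1).choose 2).choose (q + 1) := by
    have h3 := Nat.choose_succ_right_eq ((k + 1).choose 2) q
    have hqM := h.succ_le_choose hq
    have hM := h.le_choose
    set M := (k + 1).choose 2
    have h4 : (M.choose (q + 1) : ℝ) * (q + 1) = M.choose q * (M - q) := by
      have : ((M.choose (q + 1) * (q + 1) : ℕ) : ℝ) = ((M.choose q * (M - q) : ℕ) : ℝ) := by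
        rw [h3]
      rw [Nat.cast_mul, Nat.cast_mul, Nat.cast_sub (by omega)] at this
      exact_mod_cast this
    have hqr : (q + 1 : ℝ) ≤ r := by exact_mod_cast hq
    refine le_of_mul_le_mul_right ?_ (show (0 : ℝ) < r by linarith)
    calc 16 * (r : ℝ) * l * M.choose q * r = M.choose q * (16 * r ^ 2 * l) := by ring
      _ ≤ M.choose q * (M - q) := by
          gcongr
          linarith
      _ = M.choose (q + 1) * (q + 1) := h4.symm
      _ ≤ _ := by gcongr
  calc _ = n.choose (k + 1) * (16 * r * l * ((k + 1).choose 2).choose q) / 2 *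
        (1 / 2 : ℝ) ^ (k + 1).choose 2 := by ring
    _ ≤ (2 * (n - (k + 1)).choose (k + 1)) * ((k + 1).choose 2).choose (q + 1) / 2 *
        (1 / 2 : ℝ) ^ (k + 1).choose 2 := by gcongr
    _ = _ := by ring

lemma few_bound (h : Regime n k r x l) (hq : q + 1 ≤ r)
    (hE : n.choose (k + 1) * (1 / 2 : ℝ) ^ (k + 1).choose 2 ≤ x ^ 20)
    (hE' : x⁻¹ ^ 2 ≤ n.choose (k + 1) * (1 / 2 : ℝ) ^ (k + 1).choose 2) :
    n.choose (k + 1) * (((k + 1).choose 2).choose q * (1 / 2) ^ (k + 1).choose 2) *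
      (4 * overlapRatio (k + 1) (n - (k + 1)) 1 (x⁻¹ ^ 80)
        ((((k + 1).choose 2 + 1 : ℕ) : ℝ) ^ (q + 1))
        (((k + 1).choose 2).choose (q + 1) * (1 / 2) ^ (k + 1).choose 2)) ≤
      1 / (2 * l) + x⁻¹ := by
  have hx := h.x_pos
  have hl := h.l_pos
  have hr : (1 : ℝ) ≤ r := by exact_mod_cast h.one_le_r
  have h1 := choose_le_two_mul_choose_sub le_rfl h.four_mul_sq_le
  have hmean := h.many_mean_le hq
  have hC : (0 : ℝ) < n.choose (k + 1) := by exact_mod_cast Nat.choose_pos h.succ_le_n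
  have hCq : (0 : ℝ) < ((k + 1).choose 2).choose q := by
    exact_mod_cast Nat.choose_pos ((Nat.le_succ q).trans (h.succ_le_choose hq))
  have hm : n.choose (k + 1) * (((k + 1).choose 2).choose q * (1 / 2 : ℝ) ^ (k + 1).choose 2) ≤
      x ^ 21 := by
    rw [mul_left_comm (n.choose (k + 1) : ℝ)]
    calc _ ≤ x * x ^ 20 := by
          gcongr
          exact h.choose_le_x (by omega)
      _ = _ := by ring
  set m := n.choose (k + 1) * (((k + 1).choose 2).choose q * (1 / 2 : ℝ) ^ (k + 1).choose 2)
  set m' := (n - (k + 1)).choose (k + 1) *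
    (((k + 1).choose 2).choose (q + 1) * (1 / 2 : ℝ) ^ (k + 1).choose 2) with hm'
  have hm0 : 0 < m := by positivity
  have hA : m * (4 * (1 / m')) ≤ 1 / (2 * l) := by
    have h8 : 8 * l * m ≤ m' := by
      refine le_trans ?_ hmean
      have : 0 < l * m := by positivity
      nlinarith
    have hm0' : 0 < m' := lt_of_lt_of_le (by positivity) h8
    rw [mul_one_div, mul_div_assoc', div_le_div_iff₀ hm0' (by positivity)]
    linarith
  have hB : (1 : ℝ) ^ (k + 1) * 2 ^ (k + 1).choose 2 / (n - (k + 1)).choose (k + 1) ≤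
      2 * x ^ 2 := by
    rw [div_le_iff₀ (by linarith), one_pow, one_mul]
    calc (2 : ℝ) ^ (k + 1).choose 2 = x ^ 2 * x⁻¹ ^ 2 * 2 ^ (k + 1).choose 2 := by field_simp
      _ ≤ x ^ 2 * (n.choose (k + 1) * (1 / 2 : ℝ) ^ (k + 1).choose 2) *
          2 ^ (k + 1).choose 2 := by gcongr
      _ = x ^ 2 * n.choose (k + 1) * ((1 / 2) ^ (k + 1).choose 2 * 2 ^ (k + 1).choose 2) := by ring
      _ = x ^ 2 * n.choose (k + 1) := by
          rw [← mul_pow]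
          norm_num
      _ ≤ x ^ 2 * (2 * (n - (k + 1)).choose (k + 1)) := by gcongr
      _ = _ := by ring
  have hx2 : 1 ≤ x ^ 2 := one_le_pow₀ (by linarith [h.x_ge])
  unfold overlapRatio
  rw [← hm', mul_add, mul_add]
  refine add_le_add hA ?_
  calc _ ≤ x ^ 21 * (4 * (x * (k + 1 : ℝ) * x⁻¹ ^ 80 * (x ^ 2 + 2 * x ^ 2))) := by
        have h5 := h.pow_le_x hq
        push_cast at h5 ⊢
        gcongr
    _ = 12 * (k + 1) * x⁻¹ ^ 56 := by
        field_simp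
        ring
    _ ≤ x * x⁻¹ ^ 2 := by
        gcongr ?_ * ?_
        · linarith [h.succ_le, Nat.cast_nonneg (α := ℝ) k]
        · exact h.inv_pow_le (by norm_num)
    _ = x⁻¹ := by field_simp

end Regime

end SparseRegime

section Assembly

variable {n : ℕ}

lemma graphPr_numZ_sub_le_of_sparse {k r q j s : ℕ} {x l : ℝ} (h : Regime n k r x l) (hs : s < j)
    (hr : r = j * (q + 1) + s)
    (hE : n.choose (k + 1) * (1 / 2 : ℝ) ^ (k + 1).choose 2 ≤ x ^ 20)
    (hm : 1 / l ≤ n.choose (k + 1) *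
      (((k + 1).choose 2).choose q * (1 / 2 : ℝ) ^ (k + 1).choose 2)) :
    graphPr (fun G : SimpleGraph (Fin n) => j - s ≤ numZ n (k + 1) q G) - 1 / l ≤
      graphPr (fun G : SimpleGraph (Fin n) => k * r + j ≤ alphaClq n (r + 1) G) := by
  have hl := h.l_pos
  have hqr : q + 1 ≤ r := by nlinarith
  have hE' := h.inv_sq_le (q := q) (by omega)
    (E := n.choose (k + 1) * (1 / 2 : ℝ) ^ (k + 1).choose 2) (by positivity)
    (hm.trans_eq (by ring))
  have hn := h.succ_le_n
  have b1 := (graphPr_exists_overlap_le (q := q + 1) (h.smallOverlap (Nat.le_succ k) le_rfl le_rfl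
    (by omega) le_rfl (by norm_num))).trans (h.overlap_bound hqr hE)
  have b2 := (graphPr_exists_not_robust_le (κ := k + 1) (q := q + 1) (w := r * (k + 1))
    (h.smallOverlap le_rfl (Nat.le_succ k) (Nat.sub_le n (k + 1)) (by omega) (by norm_num)
      le_rfl)).trans (h.robust_bound hqr hE hE')
  have b3 := (graphPr_exists_few_le (i := q) (h.succ_le_choose hqr)
    (h.smallOverlap (Nat.le_succ k) le_rfl (Nat.sub_le n (k + 1)) (by omega) le_rfl
      (by norm_num))).trans (h.few_bound hqr hE hE')
  have hmean := h.many_mean_le hqr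
  have hsmall := h.inv_le
  have htot : 3 * x⁻¹ + 1 / (2 * l) ≤ 1 / l := by
    have e1 : 1 / (10 * l) = 1 / l / 10 := by field_simp
    have e2 : 1 / (2 * l) = 1 / l / 2 := by field_simp
    have e3 : 0 < 1 / l := by positivity
    rw [e1] at hsmall
    rw [e2]
    linarith
  refine sub_le_iff_le_add.2 ((graphPr_mono (fun G hG => ?_)).trans
    (((graphPr_or_le (fun G : SimpleGraph (Fin n) => k * r + j ≤ alphaClq n (r + 1) G) _).trans (add_le_add le_rfl ((graphPr_or_le _ _).trans
      (add_le_add b1 ((graphPr_or_le _ _).trans (add_le_add b2 b3)))))).trans ?_))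
  · by_contra hcon
    push Not at hcon
    obtain ⟨hα, h1, h2, h3⟩ := hcon
    refine absurd (le_alphaClq_of_sparse hs hr hG ?_ ?_ fun S hS hSq => ?_) hα.not_ge
    · intro S T hS hT hne hSq hTq
      by_contra hd
      exact absurd hTq (h1 S T hS hT hne hd hSq).not_ge
    · intro S hS hSq u hu v hv huv U hU
      exact h2 S hS hSq u hu v hv huv U hU
    · have h4 := h3 S hS hSq
      have h5 : (s : ℝ) ≤ r := by exact_mod_cast (by nlinarith : s ≤ r)
      have h6 : (r : ℝ) ≤ r * l * (n.choose (k + 1) *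
          (((k + 1).choose 2).choose q * (1 / 2 : ℝ) ^ (k + 1).choose 2)) := by
        rw [div_le_iff₀ hl] at hm
        nlinarith [Nat.cast_nonneg (α := ℝ) r]
      have h7 : (s : ℝ) ≤ ((Sᶜ.powersetCard (k + 1)).filter
          fun I => edgesIn G I = q + 1).card := by
        linarith [Nat.cast_nonneg (α := ℝ) r]
      exact_mod_cast h7
  · linarith

lemma graphPr_numZ_sub_le {k r j : ℕ} {x l : ℝ} (h : Regime n k r x l) (hj : 0 < j)
    (hjr : j ≤ r) :
    graphPr (fun G : SimpleGraph (Fin n) => xiD r j ≤ numZ n (k + 1) (muD r j) G) - 1 / l ≤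
      graphPr (fun G : SimpleGraph (Fin n) => k * r + j ≤ alphaClq n (r + 1) G) := by
  have hl := h.l_pos
  have hs : r % j < j := Nat.mod_lt _ hj
  have hr : r = j * (muD r j + 1) + r % j := by
    have h1 : muD r j + 1 = r / j := by
      rw [muD, ← Nat.add_div_right _ hj, Nat.sub_add_cancel hjr]
    rw [h1, Nat.div_add_mod]
  have hξ : xiD r j = j - r % j := by
    rw [xiD]
    conv_lhs => rw [hr]
    have h1 : j * (muD r j + 2) = j * (muD r j + 1) + j := by ring
    have h2 : muD (j * (muD r j + 1) + r % j) j = muD r j := by rw [← hr]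
    rw [h2, h1]
    omega
  rw [hξ]
  rcases le_or_gt (n.choose (k + 1) *
      (((k + 1).choose 2).choose (muD r j) * (1 / 2 : ℝ) ^ (k + 1).choose 2)) (1 / l) with hm | hm
  · have h1 := graphPr_le_numZ (n := n) (κ := k + 1) (i := muD r j) (ξ := j - r % j) (by omega)
    have h2 := graphPr_nonneg
      (fun G : SimpleGraph (Fin n) => k * r + j ≤ alphaClq n (r + 1) G)
    linarith
  rcases le_or_gt (n.choose (k + 1) * (1 / 2 : ℝ) ^ (k + 1).choose 2) (x ^ 20) with hE | hE
  · exact graphPr_numZ_sub_le_of_sparse h hs hr hE hm.le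
  · have h1 := (graphPr_not_robust_indep_le (w := r * (k + 1)) (h.smallOverlap (Nat.le_succ k)
      le_rfl le_rfl (by omega) le_rfl (by norm_num))).trans (h.robust_indep_bound hE.le)
    rw [graphPr_not] at h1
    have h2 : graphPr (fun G : SimpleGraph (Fin n) => ∀ U : Finset (Fin n),
        U.card ≤ r * (k + 1) → ∃ I ∈ (Finset.univ : Finset (Fin n)).powersetCard (k + 1),
          edgesIn G I = 0 ∧ Disjoint I U) ≤
        graphPr (fun G : SimpleGraph (Fin n) => k * r + j ≤ alphaClq n (r + 1) G) :=
      graphPr_mono fun G hG => (Nat.add_le_add_left hjr _).trans (le_alphaClq_of_robust hG)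
    have h3 := graphPr_le_one
      (fun G : SimpleGraph (Fin n) => j - r % j ≤ numZ n (k + 1) (muD r j) G)
    linarith

end Assembly

section Asymptotics

open Filter

lemma eventually_regime_conditions (C : ℝ) : ∀ᶠ l : ℝ in atTop,
    2 ^ C * l ^ 2 ≤ Real.exp (l / 200) ∧ 2 * 2 ^ C ≤ l ^ 2 ∧
    1000 * (3 * l) ^ 6 ≤ Real.exp (l / 200) ∧
    10 * l ≤ Real.exp (l / 200) ∧
    2 * Real.log l * (Real.log 3 + Real.log l) ≤ l / 200 ∧
    16 * Real.log l ^ 2 * l + Real.log l ≤ l ^ 2 / 2 ∧ Real.log l ≤ l ∧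
    l ≤ 2 * (l / Real.log 2) - 2 * (Real.log l / Real.log 2) - C ∧
    2 * (l / Real.log 2) - 2 * (Real.log l / Real.log 2) + C + 1 ≤ 3 * l ∧ 2 ≤ l := by
  have hpow (K : ℝ) (m : ℕ) : ∀ᶠ l : ℝ in atTop, K * l ^ m ≤ Real.exp (l / 200) := by
    have h1 : Tendsto (fun l : ℝ => l / 200) atTop atTop :=
      tendsto_id.atTop_div_const (by norm_num)
    have h2 := ((Real.tendsto_exp_div_pow_atTop m).comp h1).eventually_ge_atTop (K * 200 ^ m)
    filter_upwards [h2, eventually_gt_atTop 0] with l hl hl0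
    simp only [Function.comp] at hl
    rw [le_div_iff₀ (by positivity)] at hl
    calc K * l ^ m = K * 200 ^ m * (l / 200) ^ m := by rw [div_pow]; field_simp
      _ ≤ _ := hl
  have hlog (c : ℝ) (hc : 0 < c) : ∀ᶠ l : ℝ in atTop, Real.log l ≤ c * l := by
    filter_upwards [Real.isLittleO_log_id_atTop.bound hc, eventually_gt_atTop 0] with l h h0
    simp only [id, Real.norm_eq_abs, abs_of_pos h0] at h
    exact (le_abs_self _).trans h
  have hlog2 : ∀ᶠ l : ℝ in atTop, Real.log l ^ 2 ≤ 1 / 1000 * l := by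
    filter_upwards [(Real.isLittleO_pow_log_id_atTop (n := 2)).bound
      (by norm_num : (0 : ℝ) < 1 / 1000), eventually_gt_atTop 0] with l h h0
    simp only [id, Real.norm_eq_abs, abs_of_pos h0] at h
    exact (le_abs_self _).trans h
  have hL := Real.log_two_gt_d9
  have hL' := Real.log_two_lt_d9
  filter_upwards [hpow (2 ^ C) 2, hpow (1000 * 3 ^ 6) 6, hpow 10 1, hlog2,
    hlog (1 / 10000) (by norm_num), (tendsto_pow_atTop (two_ne_zero)).eventually_ge_atTop
      (2 * (2 : ℝ) ^ C), eventually_ge_atTop (2 : ℝ), eventually_ge_atTop (10 * C),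
    eventually_ge_atTop (20 * (C + 1))]
    with l h1 h2 h3 h4 h5 h6 h7 h8 h9
  have hll : 0 ≤ Real.log l := Real.log_nonneg (by linarith)
  have hlog3 : Real.log 3 ≤ 2 := by
    linarith [Real.log_le_sub_one_of_pos (by norm_num : (0 : ℝ) < 3)]
  have hd1 : 28 / 10 * l ≤ 2 * (l / Real.log 2) := by
    rw [← mul_div_assoc, le_div_iff₀ (by linarith)]; nlinarith
  have hd2 : 2 * (l / Real.log 2) ≤ 29 / 10 * l := by
    rw [← mul_div_assoc, div_le_iff₀ (by linarith)]; nlinarith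
  have hd3 : Real.log l / Real.log 2 ≤ 2 * Real.log l := by
    rw [div_le_iff₀ (by linarith)]; nlinarith
  have hd4 : 0 ≤ Real.log l / Real.log 2 := div_nonneg hll (by linarith)
  refine ⟨h1, h6, (by rw [mul_pow, ← mul_assoc]; exact h2), by simpa using h3, ?_, ?_, ?_, ?_, ?_, h7⟩
  · nlinarith
  · nlinarith
  · linarith
  · linarith
  · linarith

lemma eventually_regime (C : ℝ) : ∃ N : ℕ, ∀ n : ℕ, N ≤ n → ∀ k r : ℕ,
    |(k : ℝ) - (2 * Real.logb 2 n - 2 * Real.logb 2 (Real.log n))| ≤ C →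
    1 ≤ r → (r : ℝ) ≤ Real.log (Real.log n) →
    Regime n k r (Real.exp (Real.log n / 200)) (Real.log n) := by
  obtain ⟨N, hN⟩ := eventually_atTop.1
    ((Real.tendsto_log_atTop.comp tendsto_natCast_atTop_atTop).eventually
      (eventually_regime_conditions C))
  refine ⟨N + 1, fun n hn k r hk hr hrl => ?_⟩
  obtain ⟨h1, h2, h3, h4, h5, h6, h7, h8, h9, h10⟩ := hN n (by omega)
  simp only [Function.comp] at h1 h2 h3 h4 h5 h6 h7 h8 h9 h10
  have hn0 : (0 : ℝ) < n := by exact_mod_cast (by omega : 0 < n)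
  have hpow (m : ℕ) : Real.exp (Real.log n / 200) ^ (200 * m) = (n : ℝ) ^ m := by
    rw [pow_mul, ← Real.exp_nat_mul]
    congr 1
    rw [show ((200 : ℕ) : ℝ) * (Real.log n / 200) = Real.log n by push_cast; ring, Real.exp_log hn0]
  generalize hl : Real.log n = l at *
  have hl0 : 0 < l := by linarith
  have hx0 := Real.exp_pos (l / 200)
  have hL : 0 < Real.log 2 := Real.log_pos one_lt_two
  have hk' := hk
  rw [Real.logb, Real.logb, hl, abs_le] at hk
  have hkl : l ≤ k := by linarith
  have hkl' : (k : ℝ) + 1 ≤ 3 * l := by linarith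
  have hkpow : (2 : ℝ) ^ (2 * Real.logb 2 n - 2 * Real.logb 2 l) = n ^ 2 / l ^ 2 := by
    rw [Real.rpow_sub two_pos, mul_comm 2, mul_comm 2, Real.rpow_mul two_pos.le,
      Real.rpow_mul two_pos.le, Real.rpow_logb two_pos (by norm_num) hn0,
      Real.rpow_logb two_pos (by norm_num) hl0]
    norm_num
  rw [abs_le] at hk'
  have hlow : (n : ℝ) ^ 2 ≤ 2 ^ k * (2 ^ C * l ^ 2) := by
    have h := Real.rpow_le_rpow_of_exponent_le (x := 2) (by norm_num)
      (by linarith : 2 * Real.logb 2 n - 2 * Real.logb 2 l ≤ k + C)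
    rw [hkpow, Real.rpow_add two_pos, Real.rpow_natCast, div_le_iff₀ (by positivity)] at h
    linarith
  have hupp : (2 : ℝ) ^ k * l ^ 2 ≤ n ^ 2 * 2 ^ C := by
    have h := Real.rpow_le_rpow_of_exponent_le (x := 2) (by norm_num)
      (by linarith : (k : ℝ) ≤ (2 * Real.logb 2 n - 2 * Real.logb 2 l) + C)
    rw [Real.rpow_add two_pos, hkpow, Real.rpow_natCast, div_mul_eq_mul_div,
      le_div_iff₀ (by positivity)] at h
    exact h
  have hn2 := hpow 2
  have hM : ((k + 1).choose 2 : ℝ) = (k + 1) * k / 2 := by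
    rw [Nat.cast_choose_two]; push_cast; ring
  refine ⟨?_, hr, ?_, hx0, hl0, (by simpa using hpow 1), ?_, h4, ?_, ?_, ?_, ?_⟩
  · exact_mod_cast (by linarith : (1 : ℝ) ≤ k)
  · exact_mod_cast (by linarith : (r : ℝ) ≤ k)
  · refine le_trans ?_ h3
    gcongr
  · refine le_of_mul_le_mul_right ?_ hx0
    rw [← pow_succ]
    refine (hn2.le.trans hlow).trans ?_
    gcongr
  · refine le_of_mul_le_mul_right ?_ (by positivity : 0 < l ^ 2)
    rw [show (400 : ℕ) = 200 * 2 by norm_num, hn2, pow_succ]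
    have h := mul_le_mul_of_nonneg_left h2 (by positivity : 0 ≤ (n : ℝ) ^ 2)
    linarith
  · have hb : (((k + 1).choose 2 + 1 : ℕ) : ℝ) ≤ (3 * l) ^ 2 := by
      push_cast
      rw [hM]
      nlinarith
    calc (((k + 1).choose 2 + 1 : ℕ) : ℝ) ^ r ≤ ((3 * l) ^ 2) ^ r := by gcongr
      _ = Real.exp (2 * r * (Real.log 3 + Real.log l)) := by
        rw [← Real.log_mul (by norm_num) hl0.ne', mul_comm (2 * (r : ℝ)),
          Real.exp_mul, Real.exp_log (by positivity), ← pow_mul, ← Real.rpow_natCast]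
        push_cast
        rfl
      _ ≤ Real.exp (l / 200) := by
        refine Real.exp_le_exp.2 (le_trans ?_ h5)
        have h11 : 0 ≤ Real.log 3 := Real.log_nonneg (by norm_num)
        have h12 : 0 ≤ Real.log l := Real.log_nonneg (by linarith)
        gcongr
  · rw [hM]
    have h13 : 16 * (r : ℝ) ^ 2 * l + r ≤ 16 * Real.log l ^ 2 * l + Real.log l := by gcongr
    nlinarith

end Asymptotics

theorem stmt8 (C : ℝ) (hC : 0 < C) :
    ∃ ε₀ : ℝ, 0 < ε₀ ∧ ∃ N : ℕ, ∀ n : ℕ, N ≤ n → ∀ k r j : ℕ,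
      |(k : ℝ) - (2 * Real.logb 2 n - 2 * Real.logb 2 (Real.log n))| ≤ C →
      1 ≤ r → (r : ℝ) ≤ ε₀ * Real.log (Real.log n) →
      0 < j → j ≤ r →
      grPr n {G | xiD r j ≤ numZ n (k + 1) (muD r j) G} - 1 / Real.log n ≤
        grPr n {G | k * r + j ≤ alphaClq n (r + 1) G} := by
  obtain ⟨N, hN⟩ := eventually_regime C
  refine ⟨1, one_pos, N, fun n hn k r j hk hr hrl hj hjr => ?_⟩
  rw [one_mul] at hrl
  rw [grPr_eq_graphPr, grPr_eq_graphPr]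
  exact graphPr_numZ_sub_le (hN n hn k r hk hr hrl) hj hjr
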